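/- arXiv:2105.12464 — 3 statements merged into one kernel-verified Lean document; each statement's English description precedes it below -/
import Mathlib

section
/- Bifurcation inside an invariant submanifold. Let M be a topological d-manifold and f : [0,1] × M → M a continuous family of homeomorphisms of M. Let N ⊆ M be a subset which, with the subspace topology, is a topological n-manifold (every point of N has an open neighborhood in N homeomorphic to an open subset of ℝⁿ), and suppose f_λ(N) = N for every λ ∈ [0,1]. Suppose p ∈ N is such that {p} is an attractor of f₀ : M → M and {p} is a repeller of the restriction f_λ|_N : N → N for every λ ∈ (0,1]. Suppose additionally that there exists a neighborhood V of p in M, the same for all λ, such that for every λ, every x ∈ V with f_λⁿ(x) ∈ V for all n ∈ ℤ belongs to N. Then there exists λ₀ > 0 such that for every λ with 0 < λ < λ₀ there exists a compact attractor K_λ of f_λ : M → M with K_λ ⊆ N which is a topological spine of a compact subset of N homeomorphic to S^{n-1} × [0,1] (so K_λ has the Borsuk homotopy type of S^{n-1}); moreover K_λ converges to {p} upper semicontinuously as λ → 0. -/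
open Set Topology unitInterval

/-- `A` is homeomorphic to an open subset of `B`. -/
def HomeoToOpen (A : Type*) [TopologicalSpace A] (B : Type*) [TopologicalSpace B] : Prop :=
  ∃ U : Set B, IsOpen U ∧ Nonempty (A ≃ₜ U)

/-- The half-space `ℝ^{n-1} × [0,∞)`. -/
abbrev HalfSpace (n : ℕ) : Type :=
  EuclideanSpace ℝ (Fin (n - 1)) × {t : ℝ // 0 ≤ t}

/-- Every point has an open neighborhood homeomorphic to an open subset of `ℝⁿ`. -/
def LocallyEuclidean (n : ℕ) (M : Type*) [TopologicalSpace M] : Prop :=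
  ∀ x : M, ∃ V : Set M, IsOpen V ∧ x ∈ V ∧ HomeoToOpen V (EuclideanSpace ℝ (Fin n))

/-- Every point has an open neighborhood homeomorphic to an open subset of the
half-space `ℝ^{n-1} × [0,∞)`. -/
def LocallyHalfSpace (n : ℕ) (M : Type*) [TopologicalSpace M] : Prop :=
  ∀ x : M, ∃ V : Set M, IsOpen V ∧ x ∈ V ∧ HomeoToOpen V (HalfSpace n)

/-- The manifold boundary of a space: points with no open neighborhood homeomorphic to
an open subset of `ℝⁿ`. -/
def spaceBoundary (n : ℕ) (M : Type*) [TopologicalSpace M] : Set M :=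
  {x | ¬ ∃ V : Set M, IsOpen V ∧ x ∈ V ∧ HomeoToOpen V (EuclideanSpace ℝ (Fin n))}

variable {X : Type*} [TopologicalSpace X]

/-- A subset which is a compact `n`-manifold with boundary (subspace topology). -/
def IsCompactMfldBdry (n : ℕ) (N : Set X) : Prop :=
  IsCompact N ∧ LocallyHalfSpace n ↥N

/-- The boundary of a subset which is a manifold with boundary, as a subset of the
ambient space. -/
def subsetBoundary (n : ℕ) (N : Set X) : Set X :=
  Subtype.val '' spaceBoundary n ↥N

/-- `S` is bicollared in the ambient space. -/
def Bicollared (S : Set X) : Prop :=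
  ∃ b : ↥S × ↥(Set.Icc (-1 : ℝ) 1) → X,
    Topology.IsEmbedding b ∧ ∀ x : ↥S, b (x, ⟨0, by norm_num⟩) = (x : X)

/-- `M` and `N` (compact `n`-manifolds with boundary, `N ⊆ int M`) are concentric:
`M \ int N` is homeomorphic to `∂M × [0,1]`. -/
def Concentric (n : ℕ) (M N : Set X) : Prop :=
  Nonempty (↥(M \ interior N) ≃ₜ ↥(subsetBoundary n M) × ↥(Set.Icc (0 : ℝ) 1))

/-- `K` is a topological spine of the compact `n`-manifold with boundary `N`:
`K ⊆ int N` and `N \ K` is homeomorphic to `∂N × [0,∞)`. -/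
def IsSpine (n : ℕ) (N K : Set X) : Prop :=
  K ⊆ interior N ∧
    Nonempty (↥(N \ K) ≃ₜ ↥(subsetBoundary n N) × ↥(Set.Ici (0 : ℝ)))

/-- The ω-limit set of `Y` under a map `f`. -/
def omegaSet (f : X → X) (Y : Set X) : Set X :=
  ⋂ (n : ℕ) (_ : 1 ≤ n), closure (⋃ (k : ℕ) (_ : n ≤ k), f^[k] '' Y)

/-- `K` is an attractor of the homeomorphism `f`. -/
def IsAttractor (f : X ≃ₜ X) (K : Set X) : Prop :=
  IsCompact K ∧ ∃ U : Set X, U ∈ 𝓝ˢ K ∧ K = omegaSet f U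

/-- `K` is a repeller of the homeomorphism `f`. -/
def IsRepeller (f : X ≃ₜ X) (K : Set X) : Prop :=
  IsAttractor f.symm K

/-- A continuous family of homeomorphisms parametrized by the unit interval. -/
def ContinuousFamily {M : Type*} [TopologicalSpace M] (f : unitInterval → M ≃ₜ M) : Prop :=
  Continuous (fun p : unitInterval × M => f p.1 p.2) ∧
    Continuous (fun p : unitInterval × M => (f p.1).symm p.2)

/-- `M` has the concentric rigidity property (as a subset of the ambient space). -/
def ConcentricRigidity (n : ℕ) (M : Set X) : Prop :=
  ∀ M₀ M₁ : Set X, IsCompactMfldBdry n M₀ → IsCompactMfldBdry n M₁ →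
    M₀ ⊆ interior M₁ → M₁ ⊆ interior M →
    Bicollared (subsetBoundary n M₁) →
    Nonempty (↥(subsetBoundary n M₁) ≃ₜ ↥(subsetBoundary n M)) →
    Concentric n M M₀ →
    Concentric n M₁ M₀ ∧ Concentric n M M₁


/-! ### No-retraction -/

abbrev EN (n : ℕ) : Type := EuclideanSpace ℝ (Fin n)

lemma det_interp (n : ℕ) (t : ℕ → ℝ) (ht : Function.Injective t) :
    ∃ w : ℕ → ℝ, (∑ i ∈ Finset.range (n+1), w i = 1) ∧
      ∀ A : EN n →L[ℝ] EN n, (1 + A).det = ∑ i ∈ Finset.range (n+1), w i * (1 + t i • A).det := by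
  refine ⟨fun i => (Lagrange.basis (Finset.range (n+1)) t i).eval 1, ?_, ?_⟩
  · rw [← Polynomial.eval_finsetSum, Lagrange.sum_basis ht.injOn (by simp)]
    simp
  · intro A
    let b := (EuclideanSpace.basisFun (Fin n) ℝ).toBasis
    let Am := LinearMap.toMatrix b b (A : EN n →ₗ[ℝ] EN n)
    let P : Polynomial ℝ :=
      Matrix.det ((Polynomial.X : Polynomial ℝ) • Am.map Polynomial.C + (1 : Matrix (Fin n) (Fin n) ℝ).map Polynomial.C)
    have hP : ∀ s : ℝ, (1 + s • A).det = P.eval s := by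
      intro s
      have h1 : (1 + s • A).det = Matrix.det (1 + s • Am) := by
        rw [ContinuousLinearMap.det, ← LinearMap.det_toMatrix b]
        congr 1
        simp only [ContinuousLinearMap.toLinearMap_add, ContinuousLinearMap.toLinearMap_smul, map_add, map_smul]
        congr 1
        exact LinearMap.toMatrix_id b
      rw [h1]
      simp only [P]
      rw [← Polynomial.coe_evalRingHom, RingHom.map_det]
      congr 1
      ext i j
      simp [Matrix.map_apply, Matrix.one_apply]
      split_ifs <;> simp <;> ring
    have hdeg : P.degree < (Finset.range (n+1)).card := by
      refine lt_of_le_of_lt Polynomial.degree_le_natDegree ?_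
      have := Polynomial.natDegree_det_X_add_C_le Am (1 : Matrix (Fin n) (Fin n) ℝ)
      simp only [Fintype.card_fin] at this
      simp only [Finset.card_range]
      exact_mod_cast Nat.lt_succ_of_le this
    have := Lagrange.eq_interpolate (s := Finset.range (n+1)) (v := t) ht.injOn hdeg
    have h2 := congrArg (Polynomial.eval 1) this
    have h3 := hP 1
    rw [one_smul] at h3
    rw [h3, h2, Lagrange.interpolate_apply, Polynomial.eval_finsetSum]
    refine Finset.sum_congr rfl fun i _ => ?_
    rw [Polynomial.eval_mul, Polynomial.eval_C, hP, mul_comm]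

lemma det_pos_small {n : ℕ} (A : EN n →L[ℝ] EN n) (hA : ‖A‖ < 1) : 0 < (1 + A).det := by
  by_contra hcon
  push Not at hcon
  have hc : ContinuousOn (fun s : ℝ => (1 + s • A).det) (Icc 0 1) := by
    apply Continuous.continuousOn
    exact ContinuousLinearMap.continuous_det.comp (by fun_prop)
  have := intermediate_value_Icc' (zero_le_one' ℝ) hc
  have h0 : (0 : ℝ) ∈ Icc ((1 + (1:ℝ) • A).det) ((1 + (0:ℝ) • A).det) := by
    constructor
    · simpa using hcon
    · simp [ContinuousLinearMap.det]
      
  obtain ⟨s, hs, hs0⟩ := this h0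
  have hu : IsUnit (1 + s • A) := by
    have hlt : ‖-(s • A)‖ < 1 := by
      rw [norm_neg, norm_smul, Real.norm_eq_abs, abs_of_nonneg hs.1]
      nlinarith [hs.1, hs.2, norm_nonneg A]
    have := isUnit_one_sub_of_norm_lt_one hlt
    simpa using this
  have hu2 : IsUnit ((1 + s • A).det) := by
    obtain ⟨u, hu⟩ := hu
    rw [← hu]
    have h1 : ((u : EN n →L[ℝ] EN n) : EN n →ₗ[ℝ] EN n) ∘ₗ (((u⁻¹ : (EN n →L[ℝ] EN n)ˣ) : EN n →L[ℝ] EN n) : EN n →ₗ[ℝ] EN n) = LinearMap.id := by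
      ext1 x
      have : (u : EN n →L[ℝ] EN n) * ((u⁻¹ : (EN n →L[ℝ] EN n)ˣ) : EN n →L[ℝ] EN n) = 1 := u.mul_inv
      exact DFunLike.congr_fun this x
    have h2 := congrArg LinearMap.det h1
    rw [LinearMap.det_comp, LinearMap.det_id] at h2
    exact IsUnit.of_mul_eq_one _ h2
  exact hu2.ne_zero hs0

lemma vol_poly {n : ℕ} (w : EN n → EN n) (hw : ContDiff ℝ 1 w)
    (hw0 : ∀ x, ‖x‖ = 1 → w x = 0) :
    ∫ x in Metric.ball (0 : EN n) 1, (1 + fderiv ℝ w x).det =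
      MeasureTheory.volume.real (Metric.ball (0 : EN n) 1) := by
  have hcd : Continuous (fderiv ℝ w) := hw.continuous_fderiv (by norm_num)
  obtain ⟨L, hL⟩ : ∃ L : ℝ, ∀ x ∈ Metric.closedBall (0 : EN n) 1, ‖fderiv ℝ w x‖ ≤ L := by
    obtain ⟨L, hL⟩ := (isCompact_closedBall (0 : EN n) 1).exists_bound_of_continuousOn hcd.continuousOn
    exact ⟨L, hL⟩
  have hL0 : 0 ≤ L := (norm_nonneg _).trans (hL 0 (by simp))
  have hlip : ∀ x ∈ Metric.closedBall (0 : EN n) 1, ∀ y ∈ Metric.closedBall (0 : EN n) 1,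
      ‖w y - w x‖ ≤ L * ‖y - x‖ := by
    intro x hx y hy
    exact (convex_closedBall (0 : EN n) 1).norm_image_sub_le_of_norm_fderiv_le
      (fun z _ => (hw.differentiable (by norm_num)) z) hL hx hy
  classical
  let u : EN n → EN n := fun x => if ‖x‖ < 1 then w x else 0
  have hu1 : ∀ x, ‖x‖ < 1 → ∀ y, 1 ≤ ‖y‖ → ‖w x‖ ≤ 2 * L * ‖x - y‖ := by
    intro x hx y hy
    have hyp : 0 < ‖y‖ := by linarith
    set z := (‖y‖⁻¹) • y with hz
    have hzn : ‖z‖ = 1 := by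
      rw [hz, norm_smul, norm_inv, norm_norm, inv_mul_cancel₀ hyp.ne']
    have h1 := hlip z (by simp [hzn]) x (by simpa using hx.le)
    rw [hw0 z hzn, sub_zero] at h1
    have h2 : ‖y - z‖ = ‖y‖ - 1 := by
      have : y - z = (1 - ‖y‖⁻¹) • y := by rw [hz, sub_smul, one_smul]
      rw [this, norm_smul, Real.norm_eq_abs, abs_of_nonneg, sub_mul, inv_mul_cancel₀ hyp.ne', one_mul]
      have := inv_le_one_of_one_le₀ hy
      linarith
    have h3 : ‖y‖ - ‖x‖ ≤ ‖x - y‖ := by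
      rw [norm_sub_rev]; exact norm_sub_norm_le y x
    have h4 : ‖x - z‖ ≤ ‖x - y‖ + ‖y - z‖ := norm_sub_le_norm_sub_add_norm_sub x y z
    nlinarith
  have hulip : ∀ x y, ‖u x - u y‖ ≤ 2 * L * ‖x - y‖ := by
    intro x y
    by_cases hx : ‖x‖ < 1 <;> by_cases hy : ‖y‖ < 1
    · simp only [u, hx, hy, if_true]
      have := hlip y (by simpa using hy.le) x (by simpa using hx.le)
      nlinarith [norm_nonneg (x - y)]
    · simp only [u, hx, hy, if_true, if_false, sub_zero]
      exact hu1 x hx y (not_lt.1 hy)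
    · simp only [u, hx, hy, if_true, if_false, zero_sub, norm_neg]
      rw [norm_sub_rev]
      exact hu1 y hy x (not_lt.1 hx)
    · simp only [u, hx, hy, if_false, sub_zero, norm_zero]
      positivity
  -- small parameter
  have key : ∀ t : ℝ, 0 ≤ t → 2 * L * t < 1 →
      ∫ x in Metric.ball (0 : EN n) 1, (1 + t • fderiv ℝ w x).det =
      MeasureTheory.volume.real (Metric.ball (0 : EN n) 1) := by
    intro t ht htL
    let h : EN n → EN n := fun x => x + t • u x
    have happ : ApproximatesLinearOn h ((ContinuousLinearEquiv.refl ℝ (EN n)) : EN n →L[ℝ] EN n)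
        univ (Real.toNNReal (2 * L * t)) := by
      intro x _ y _
      have : h x - h y - ((ContinuousLinearEquiv.refl ℝ (EN n)) : EN n →L[ℝ] EN n) (x - y)
          = t • (u x - u y) := by
        simp only [h, ContinuousLinearEquiv.coe_refl, ContinuousLinearMap.coe_id', id_eq, smul_sub]
        abel
      rw [this, norm_smul, Real.norm_eq_abs, abs_of_nonneg ht, Real.coe_toNNReal _ (by positivity)]
      nlinarith [hulip x y]
    have hcN : Subsingleton (EN n) ∨ Real.toNNReal (2 * L * t) <
        ‖((ContinuousLinearEquiv.refl ℝ (EN n)).symm : EN n →L[ℝ] EN n)‖₊⁻¹ := by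
      rcases subsingleton_or_nontrivial (EN n) with hs | hs
      · exact Or.inl hs
      · right
        have : ‖((ContinuousLinearEquiv.refl ℝ (EN n)).symm : EN n →L[ℝ] EN n)‖₊ = 1 := by
          apply NNReal.eq
          simp
        rw [this, inv_one, Real.toNNReal_lt_one]
        exact htL
    have hinj : Function.Injective h := by
      have := happ.injOn hcN
      exact fun x y hxy => this (mem_univ x) (mem_univ y) hxy
    have hsurj : Function.Surjective h := happ.surjective hcN
    have hout : ∀ x, ¬ ‖x‖ < 1 → h x = x := by
      intro x hx
      simp [h, u, hx]
    have himg : h '' Metric.ball (0 : EN n) 1 = Metric.ball (0 : EN n) 1 := by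
      ext y
      simp only [mem_image, mem_ball_zero_iff]
      constructor
      · rintro ⟨x, hx, rfl⟩
        by_contra hc
        have := hinj (hout _ hc)
        rw [this] at hc
        exact hc hx
      · intro hy
        obtain ⟨x, rfl⟩ := hsurj y
        refine ⟨x, ?_, rfl⟩
        by_contra hc
        rw [hout x hc] at hy
        exact hc hy
    have hder : ∀ x ∈ Metric.ball (0 : EN n) 1,
        HasFDerivWithinAt h (1 + t • fderiv ℝ w x) (Metric.ball (0 : EN n) 1) x := by
      intro x hx
      have h1 : HasFDerivAt (fun x => x + t • w x) (1 + t • fderiv ℝ w x) x := by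
        have := ((hw.differentiable (by norm_num)) x).hasFDerivAt
        exact (hasFDerivAt_id x).add (this.const_smul t)
      refine h1.hasFDerivWithinAt.congr (fun y hy => ?_) ?_
      · have : ‖y‖ < 1 := by simpa using hy
        simp [h, u, this]
      · have : ‖x‖ < 1 := by simpa using hx
        simp [h, u, this]
    have hcv := MeasureTheory.integral_image_eq_integral_abs_det_fderiv_smul MeasureTheory.volume
      (measurableSet_ball) hder hinj.injOn (fun _ => (1 : ℝ))
    rw [himg] at hcv
    simp only [smul_eq_mul, mul_one, MeasureTheory.integral_const, MeasurableSet.univ, MeasureTheory.measureReal_restrict_apply, univ_inter] at hcv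
    rw [hcv]
    refine MeasureTheory.setIntegral_congr_fun measurableSet_ball fun x hx => ?_
    rw [abs_of_pos]
    apply det_pos_small
    rw [norm_smul, Real.norm_eq_abs, abs_of_nonneg ht]
    have := hL x (Metric.ball_subset_closedBall hx)
    nlinarith [norm_nonneg (fderiv ℝ w x)]
  -- interpolation
  let t : ℕ → ℝ := fun i => (i : ℝ) / ((n + 1) * (2 * L + 1))
  have hden : 0 < ((n : ℝ) + 1) * (2 * L + 1) := by positivity
  have htinj : Function.Injective t := by
    intro i j hij
    simp only [t] at hij
    rw [div_left_inj' hden.ne'] at hij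
    exact_mod_cast hij
  obtain ⟨c, hc1, hc2⟩ := det_interp n t htinj
  have hint : ∀ s : ℝ, MeasureTheory.IntegrableOn (fun x => (1 + s • fderiv ℝ w x).det)
      (Metric.ball (0 : EN n) 1) := by
    intro s
    have : Continuous (fun x => (1 + s • fderiv ℝ w x).det) :=
      ContinuousLinearMap.continuous_det.comp (by fun_prop)
    exact (this.continuousOn.integrableOn_compact (isCompact_closedBall (0 : EN n) 1)).mono_set
      Metric.ball_subset_closedBall
  rw [MeasureTheory.setIntegral_congr_fun measurableSet_ball (fun x _ => hc2 (fderiv ℝ w x))]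
  rw [MeasureTheory.integral_finsetSum _ (fun i _ => (hint (t i)).const_mul (c i))]
  simp_rw [MeasureTheory.integral_const_mul]
  rw [Finset.sum_congr rfl (g := fun i => c i * MeasureTheory.volume.real (Metric.ball (0 : EN n) 1)),
    ← Finset.sum_mul, hc1, one_mul]
  intro i hi
  rw [key (t i) (by simp only [t]; positivity)]
  simp only [t]
  have hi' : (i : ℝ) ≤ n := by
    have := Finset.mem_range.1 hi
    exact_mod_cast Nat.lt_succ_iff.1 this
  rw [← mul_div_assoc, div_lt_one hden]
  nlinarith

theorem exists_zero_of_id_outside {n : ℕ} (F : EN n → EN n) (hF : Continuous F)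
    (hid : ∀ x, 1 ≤ ‖x‖ → F x = x) : ∃ x, F x = 0 := by
  by_contra hcon
  push Not at hcon
  obtain ⟨c, hc, hcF⟩ : ∃ c : ℝ, 0 < c ∧ ∀ x, c ≤ ‖F x‖ := by
    obtain ⟨x0, _, hx0⟩ := (isCompact_closedBall (0 : EN n) 1).exists_isMinOn ⟨0, by simp⟩
      (hF.norm.continuousOn)
    refine ⟨min 1 ‖F x0‖, lt_min one_pos (norm_pos_iff.2 (hcon x0)), fun x => ?_⟩
    by_cases hx : 1 ≤ ‖x‖
    · rw [hid x hx]; exact (min_le_left _ _).trans hx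
    · exact (min_le_right _ _).trans (hx0 (by simpa using (not_le.1 hx).le))
  obtain ⟨g, hg1, hg2, hg3⟩ := Continuous.exists_contDiff_approx (f := fun x => F x - x)
    (ε := fun _ => c) 1 (by fun_prop) (by fun_prop) (fun _ => hc)
  let G : EN n → EN n := fun x => x + g x
  have hGc : ContDiff ℝ 1 G := contDiff_id.add (by exact_mod_cast hg1)
  have hGid : ∀ x, 1 ≤ ‖x‖ → G x = x := by
    intro x hx
    have : g x = 0 := by
      by_contra h
      have := hg3 (a := x) h
      simp [hid x hx] at this
    simp [G, this]
  have hG0 : ∀ x, G x ≠ 0 := by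
    intro x hx
    have h1 := hg2 x
    rw [dist_eq_norm] at h1
    have : g x - (F x - x) = - F x := by
      have : g x = - x := by
        have : x + g x = 0 := hx
        exact eq_neg_of_add_eq_zero_right this
      rw [this]; abel
    rw [this, norm_neg] at h1
    exact absurd (hcF x) (not_le.2 h1)
  let r : EN n → EN n := fun x => (‖G x‖)⁻¹ • G x
  have hrc : ContDiff ℝ 1 r := by
    have h1 : ContDiff ℝ 1 (fun x => (‖G x‖)⁻¹) :=
      (hGc.norm ℝ hG0).inv (fun x => norm_ne_zero_iff.2 (hG0 x))
    exact h1.smul hGc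
  have hrn : ∀ x, ‖r x‖ = 1 := by
    intro x
    simp only [r]
    rw [norm_smul, norm_inv, norm_norm, inv_mul_cancel₀ (norm_ne_zero_iff.2 (hG0 x))]
  have hw : ContDiff ℝ 1 (fun x => r x - x) := hrc.sub contDiff_id
  have := vol_poly (fun x => r x - x) hw (by
    intro x hx
    simp [r, hGid x hx.ge, hx])
  have hdet : ∀ x, (1 + fderiv ℝ (fun x => r x - x) x).det = 0 := by
    intro x
    have hd := ((hrc.differentiable (by norm_num)) x).hasFDerivAt
    have h1 : fderiv ℝ (fun x => r x - x) x = fderiv ℝ r x - 1 :=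
      (hd.sub (hasFDerivAt_id x)).fderiv
    rw [h1, add_sub_cancel]
    by_contra hne
    have hs : Function.Surjective (fderiv ℝ r x : EN n →ₗ[ℝ] EN n) := by
      have := (LinearMap.equivOfDetNeZero (fderiv ℝ r x : EN n →ₗ[ℝ] EN n) hne).surjective
      exact this
    obtain ⟨v, hv⟩ := hs (r x)
    have h2 : HasFDerivAt (fun y => inner ℝ (r y) (r y)) _ x := hd.inner ℝ hd
    have h3 : (fun y => inner ℝ (r y) (r y)) = fun _ => (1 : ℝ) := by
      ext y; rw [real_inner_self_eq_norm_sq, hrn]; norm_num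
    rw [h3] at h2
    have h4 := h2.unique (hasFDerivAt_const (1 : ℝ) x)
    have h5 := DFunLike.congr_fun h4 v
    have hv' : fderiv ℝ r x v = r x := hv
    simp [fderivInnerCLM_apply, hv', real_inner_self_eq_norm_sq, hrn] at h5
  simp_rw [hdet] at this
  simp only [MeasureTheory.integral_zero] at this
  have hpos : 0 < MeasureTheory.volume.real (Metric.ball (0 : EN n) 1) := by
    apply ENNReal.toReal_pos
    · exact (Metric.measure_ball_pos _ _ one_pos).ne'
    · exact MeasureTheory.measure_ball_lt_top.ne
  linarith


/-! ### Extension by the identity, boundaries -/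

lemma ext_id {Y Z : Type*} [TopologicalSpace Y] [TopologicalSpace Z] [T2Space Z] {c : Y → Z}
    (hc : IsOpenEmbedding c) {φ : Y → Y} (hφ : Continuous φ) {K : Set Y} (hK : IsCompact K)
    (hφK : ∀ y, y ∉ K → φ y = y) :
    ∃ Φ : Z → Z, Continuous Φ ∧ (∀ y, Φ (c y) = c (φ y)) ∧ ∀ x, x ∉ c '' K → Φ x = x := by
  classical
  let Φ : Z → Z := fun x => if h : ∃ y, c y = x then c (φ h.choose) else x
  have h1 : ∀ y, Φ (c y) = c (φ y) := by
    intro y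
    have h : ∃ y', c y' = c y := ⟨y, rfl⟩
    simp only [Φ, dif_pos h]
    rw [hc.injective h.choose_spec]
  have h2 : ∀ x, x ∉ c '' K → Φ x = x := by
    intro x hx
    by_cases h : ∃ y, c y = x
    · obtain ⟨y, rfl⟩ := h
      rw [h1, hφK y (fun hy => hx ⟨y, hy, rfl⟩)]
    · simp only [Φ, dif_neg h]
  refine ⟨Φ, ?_, h1, h2⟩
  rw [continuous_iff_continuousAt]
  intro x
  by_cases h : ∃ y, c y = x
  · obtain ⟨y, rfl⟩ := h
    rw [← hc.continuousAt_iff]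
    have : Φ ∘ c = c ∘ φ := funext h1
    rw [this]
    exact (hc.continuous.comp hφ).continuousAt
  · have hx : x ∈ (c '' K)ᶜ := fun ⟨y, _, hy⟩ => h ⟨y, hy⟩
    have ho : IsOpen (c '' K)ᶜ := (hK.image hc.continuous).isClosed.isOpen_compl
    refine continuousAt_id.congr ?_
    filter_upwards [ho.mem_nhds hx] with z hz
    exact (h2 z hz).symm

lemma ext_homeo {Y Z : Type*} [TopologicalSpace Y] [TopologicalSpace Z] [T2Space Z] {c : Y → Z}
    (hc : IsOpenEmbedding c) (φ : Y ≃ₜ Y) {K : Set Y} (hK : IsCompact K)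
    (hφK : ∀ y, y ∉ K → φ y = y) :
    ∃ Φ : Z ≃ₜ Z, (∀ y, Φ (c y) = c (φ y)) ∧ ∀ x, x ∉ c '' K → Φ x = x := by
  have hφK' : ∀ y, y ∉ K → φ.symm y = y := by
    intro y hy
    rw [φ.symm_apply_eq, hφK y hy]
  obtain ⟨Φ, h1, h2, h3⟩ := ext_id hc φ.continuous hK hφK
  obtain ⟨Ψ, k1, k2, k3⟩ := ext_id hc φ.symm.continuous hK hφK'
  refine ⟨⟨⟨Φ, Ψ, ?_, ?_⟩, h1, k1⟩, h2, h3⟩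
  · intro x
    by_cases hx : x ∈ c '' K
    · obtain ⟨y, _, rfl⟩ := hx
      rw [h2, k2, φ.symm_apply_apply]
    · rw [h3 x hx, k3 x hx]
  · intro x
    by_cases hx : x ∈ c '' K
    · obtain ⟨y, _, rfl⟩ := hx
      rw [k2, h2, φ.apply_symm_apply]
    · rw [k3 x hx, h3 x hx]

lemma spaceBoundary_homeo {Y Z : Type*} [TopologicalSpace Y] [TopologicalSpace Z] (n : ℕ)
    (e : Y ≃ₜ Z) (y : Y) : y ∈ spaceBoundary n Y ↔ e y ∈ spaceBoundary n Z := by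
  simp only [spaceBoundary, mem_ofPred_eq, not_iff_not]
  constructor
  · rintro ⟨V, hV, hy, U, hU, ⟨h⟩⟩
    exact ⟨e '' V, e.isOpenMap V hV, ⟨y, hy, rfl⟩, U, hU, ⟨(e.image V).symm.trans h⟩⟩
  · rintro ⟨V, hV, hy, U, hU, ⟨h⟩⟩
    refine ⟨e ⁻¹' V, hV.preimage e.continuous, hy, U, hU, ⟨Homeomorph.trans ?_ h⟩⟩
    exact e.sets rfl

/-- the closed annulus -/
def annu (n : ℕ) (a b : ℝ) : Set (EN n) := {x | ‖x‖ ∈ Icc a b}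

lemma no_pushoff {n : ℕ} (F : EN n → EN n) (hF : Continuous F) (q : EN n) (ρ : ℝ) (hρ : 0 < ρ)
    (hid : ∀ x, x ∉ Metric.ball q ρ → F x = x) : ∃ x, F x = q := by
  obtain ⟨x, hx⟩ := exists_zero_of_id_outside (fun x => ρ⁻¹ • (F (q + ρ • x) - q)) (by fun_prop) (by
    intro x hx
    rw [hid]
    · rw [add_sub_cancel_left, smul_smul, inv_mul_cancel₀ hρ.ne', one_smul]
    · simp only [Metric.mem_ball, dist_self_add_left, norm_smul, Real.norm_eq_abs, abs_of_pos hρ]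
      nlinarith)
  refine ⟨q + ρ • x, ?_⟩
  have := (smul_eq_zero.1 hx).resolve_left (inv_ne_zero hρ.ne')
  exact sub_eq_zero.1 this

lemma annu_bdry {n : ℕ} {a b : ℝ} (ha : 0 < a) (hab : a < b) (z : annu n a b) :
    z ∈ spaceBoundary n (annu n a b) ↔ ‖(z : EN n)‖ = a ∨ ‖(z : EN n)‖ = b := by
  constructor
  · intro hz
    by_contra hcon
    push Not at hcon
    apply hz
    have hz2 := z.2
    simp only [annu, mem_ofPred_eq, mem_Icc] at hz2
    have ho : IsOpen {x : EN n | ‖x‖ ∈ Ioo a b} := isOpen_Ioo.preimage continuous_norm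
    refine ⟨Subtype.val ⁻¹' {x : EN n | ‖x‖ ∈ Ioo a b}, ho.preimage continuous_subtype_val,
      ⟨lt_of_le_of_ne hz2.1 hcon.1.symm, lt_of_le_of_ne hz2.2 hcon.2⟩,
      {x : EN n | ‖x‖ ∈ Ioo a b}, ho, ⟨?_⟩⟩
    refine ⟨⟨fun x => ⟨x.1.1, x.2⟩, fun x => ⟨⟨x.1, Ioo_subset_Icc_self x.2⟩, x.2⟩, fun x => rfl, fun x => rfl⟩, ?_, ?_⟩
    · exact (continuous_subtype_val.comp continuous_subtype_val).subtype_mk _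
    · exact (continuous_subtype_val.subtype_mk _).subtype_mk _
  · rintro hz ⟨V, hV, hzV, U, hU, ⟨h⟩⟩
    have hc : IsOpenEmbedding (fun v : V => ((h v : U) : EN n)) :=
      hU.isOpenEmbedding_subtypeVal.comp h.isOpenEmbedding
    set c : V → EN n := fun v => ((h v : U) : EN n) with hcdef
    set q : EN n := c ⟨z, hzV⟩ with hq
    obtain ⟨ρ, hρ, hρU⟩ := Metric.isOpen_iff.1 hU q (h ⟨z, hzV⟩).2
    -- a small neighbourhood of z in the annulus
    have hW : {v : V | c v ∈ Metric.ball q ρ} ∈ 𝓝 (⟨z, hzV⟩ : V) :=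
      hc.continuous.continuousAt.preimage_mem_nhds (Metric.ball_mem_nhds _ hρ)
    have hW2 : (Subtype.val : V → annu n a b) '' {v : V | c v ∈ Metric.ball q ρ} ∈ 𝓝 z :=
      hV.isOpenEmbedding_subtypeVal.isOpenMap.image_mem_nhds hW
    obtain ⟨δ', hδ', hδW⟩ := Metric.mem_nhds_iff.1 hW2
    obtain ⟨δ, hδ, hδδ⟩ : ∃ δ : ℝ, 0 < δ ∧ 2 * δ < δ' := ⟨δ' / 4, by linarith, by linarith⟩
    have hb : 0 < b := ha.trans hab
    let η : EN n → ℝ := fun x => max 0 (δ - ‖x - (z : EN n)‖) / ((1 + δ) * (1 + b))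
    have hηc : Continuous η := by fun_prop
    have hη0 : ∀ x, 0 ≤ η x := fun x => by positivity
    have hη1 : ∀ x, η x ≤ 1 := by
      intro x
      rw [div_le_one (by positivity)]
      have : max 0 (δ - ‖x - (z : EN n)‖) ≤ δ := max_le hδ.le (by linarith [norm_nonneg (x - (z : EN n))])
      nlinarith
    have hηb : ∀ x, η x * b ≤ δ := by
      intro x
      rw [div_mul_eq_mul_div, div_le_iff₀ (by positivity)]
      have : max 0 (δ - ‖x - (z : EN n)‖) ≤ δ := max_le hδ.le (by linarith [norm_nonneg (x - (z : EN n))])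
      have h1 : max 0 (δ - ‖x - (z : EN n)‖) * b ≤ δ * b := by nlinarith
      nlinarith [mul_pos hδ hδ, mul_pos hδ hb, mul_pos (mul_pos hδ hδ) hb]
    have hηz : 0 < η z := by
      simp only [η, sub_self, norm_zero, sub_zero]
      have : 0 < max 0 δ := lt_max_of_lt_right hδ
      positivity
    have hηo : ∀ x, δ ≤ ‖x - (z : EN n)‖ → η x = 0 := by
      intro x hx
      simp only [η]
      rw [max_eq_left (by linarith), zero_div]
    let m : ℝ := (a + b) / 2
    let ψ : EN n → EN n := fun x => ((1 - η x) + η x * (m / ‖x‖)) • x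
    have hψn : ∀ x : EN n, x ≠ 0 → ‖ψ x‖ = (1 - η x) * ‖x‖ + η x * m := by
      intro x hx
      have hx' : 0 < ‖x‖ := norm_pos_iff.2 hx
      have hm : 0 < m := by simp only [m]; linarith
      rw [norm_smul, Real.norm_eq_abs, abs_of_nonneg, add_mul, mul_assoc, div_mul_cancel₀ _ hx'.ne']
      have := hη0 x
      have := hη1 x
      have : 0 ≤ m / ‖x‖ := by positivity
      nlinarith [mul_nonneg (hη0 x) this]
    have hne : ∀ x ∈ annu n a b, x ≠ 0 := by
      rintro x hx rfl
      simp only [annu, mem_ofPred_eq, norm_zero, mem_Icc] at hx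
      linarith [hx.1]
    have hψT : ∀ x ∈ annu n a b, ψ x ∈ annu n a b := by
      intro x hx
      have h1 := hψn x (hne x hx)
      simp only [annu, mem_ofPred_eq, mem_Icc] at hx ⊢
      rw [h1]
      have := hη0 x
      have := hη1 x
      simp only [m]
      constructor <;> nlinarith
    have hψd : ∀ x ∈ annu n a b, ‖ψ x - x‖ ≤ δ := by
      intro x hx
      have hx' : 0 < ‖x‖ := norm_pos_iff.2 (hne x hx)
      have h1 : ψ x - x = (η x * (m / ‖x‖ - 1)) • x := by
        simp only [ψ]
        module
      rw [h1, norm_smul, Real.norm_eq_abs, abs_mul, abs_of_nonneg (hη0 x), mul_assoc]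
      have h2 : |m / ‖x‖ - 1| * ‖x‖ = |m - ‖x‖| := by
        nth_rewrite 2 [← abs_of_pos hx']
        rw [← abs_mul, sub_mul, div_mul_cancel₀ _ hx'.ne', one_mul]
      rw [h2]
      refine le_trans ?_ (hηb x)
      apply mul_le_mul_of_nonneg_left _ (hη0 x)
      simp only [annu, mem_ofPred_eq, mem_Icc] at hx
      simp only [m]
      rw [abs_le]; constructor <;> linarith [hx.1, hx.2]
    have hψz : ∀ x ∈ annu n a b, ψ x ≠ z := by
      intro x hx hxz
      have h1 := hψn x (hne x hx)
      rw [hxz] at h1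
      have hx2 := hx
      simp only [annu, mem_ofPred_eq, mem_Icc] at hx2
      have h0 := hη0 x
      have h01 := hη1 x
      have hη : η x = 0 := by
        by_contra hne
        have hpos : 0 < η x := lt_of_le_of_ne h0 (Ne.symm hne)
        simp only [m] at h1
        rcases hz with hz | hz <;> rw [hz] at h1 <;> nlinarith
      have : ψ x = x := by simp [ψ, hη]
      rw [this] at hxz
      rw [hxz] at hη
      exact hηz.ne' hη
    have hψo : ∀ x, δ ≤ ‖x - (z : EN n)‖ → ψ x = x := by
      intro x hx; simp [ψ, hηo x hx]
    have hball : ∀ x : annu n a b, ‖(x : EN n) - (z : EN n)‖ < 2 * δ + (δ' - 2 * δ) →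
        ∃ hv : x ∈ V, c ⟨x, hv⟩ ∈ Metric.ball q ρ := by
      intro x hx
      have : x ∈ Metric.ball z δ' := by
        rw [Metric.mem_ball, Subtype.dist_eq, dist_eq_norm]; linarith
      obtain ⟨v, hv, hvx⟩ := hδW this
      subst hvx
      exact ⟨v.2, hv⟩
    have hφV : ∀ v : V, (⟨ψ v.1, hψT _ v.1.2⟩ : annu n a b) ∈ V := by
      intro v
      by_cases hv : δ ≤ ‖(v.1 : EN n) - (z : EN n)‖
      · have : (⟨ψ v.1, hψT _ v.1.2⟩ : annu n a b) = v.1 := Subtype.ext (hψo _ hv)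
        rw [this]; exact v.2
      · refine (hball _ ?_).choose
        have h1 := hψd _ v.1.2
        have h2 : ‖ψ v.1 - (z : EN n)‖ ≤ ‖ψ v.1 - v.1‖ + ‖(v.1 : EN n) - (z : EN n)‖ :=
          norm_sub_le_norm_sub_add_norm_sub _ _ _
        simp only
        linarith
    let φ : V → V := fun v => ⟨⟨ψ v.1, hψT _ v.1.2⟩, hφV v⟩
    have hφc : Continuous φ := by
      refine Continuous.subtype_mk (Continuous.subtype_mk ?_ _) _
      have hcv : Continuous (fun v : V => (v.1 : EN n)) :=
        continuous_subtype_val.comp continuous_subtype_val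
      suffices hs : Continuous (fun v : V => (1 - η (v.1 : EN n)) + η (v.1 : EN n) * (m / ‖(v.1 : EN n)‖)) from
        hs.smul hcv
      have hηv : Continuous (fun v : V => η (v.1 : EN n)) := hηc.comp hcv
      refine (continuous_const.sub hηv).add (hηv.mul (continuous_const.div hcv.norm ?_))
      intro v
      exact norm_ne_zero_iff.2 (hne _ v.1.2)
    have hTc : IsCompact (annu n a b) := by
      refine (isCompact_closedBall (0 : EN n) b).of_isClosed_subset
        (isClosed_Icc.preimage continuous_norm) ?_
      intro x hx
      simpa using hx.2
    have : CompactSpace (annu n a b) := isCompact_iff_compactSpace.1 hTc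
    have hKc : IsCompact {v : V | ‖((v : annu n a b) : EN n) - (z : EN n)‖ ≤ δ} := by
      rw [hV.isOpenEmbedding_subtypeVal.isEmbedding.isCompact_iff]
      have : (Subtype.val : V → annu n a b) '' {v : V | ‖((v : annu n a b) : EN n) - (z : EN n)‖ ≤ δ}
          = {x : annu n a b | ‖(x : EN n) - (z : EN n)‖ ≤ δ} := by
        ext x
        constructor
        · rintro ⟨v, hv, rfl⟩; exact hv
        · intro hx
          have hx' : ‖(x : EN n) - (z : EN n)‖ ≤ δ := hx
          obtain ⟨hv, _⟩ := hball x (by linarith)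
          exact ⟨⟨x, hv⟩, hx, rfl⟩
      rw [this]
      exact (isClosed_le (by fun_prop) continuous_const).isCompact
    obtain ⟨F, hFc, hF1, hF2⟩ := ext_id hc hφc hKc (by
      intro v hv
      simp only [mem_ofPred_eq, not_le] at hv
      exact Subtype.ext (Subtype.ext (hψo _ hv.le)))
    obtain ⟨y, hy⟩ := no_pushoff F hFc q ρ hρ (by
      intro x hx
      apply hF2
      rintro ⟨v, hv, rfl⟩
      have hv' : ‖((v : annu n a b) : EN n) - (z : EN n)‖ ≤ δ := hv
      obtain ⟨_, hv2⟩ := hball v.1 (by linarith)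
      exact hx hv2)
    by_cases hyr : y ∈ range c
    · obtain ⟨v, rfl⟩ := hyr
      rw [hF1] at hy
      have := hc.injective hy
      have h2 := congrArg (fun v : V => ((v : annu n a b) : EN n)) this
      exact hψz _ v.1.2 h2
    · rw [hF2 y (fun ⟨v, _, hv⟩ => hyr ⟨v, hv⟩)] at hy
      exact hyr ⟨_, hy.symm⟩


/-! ### Radial homeomorphisms and limits -/

noncomputable def radMap {n : ℕ} (φ : ℝ → ℝ) (x : EN n) : EN n := (φ ‖x‖ / ‖x‖) • x

lemma radMap_id {n : ℕ} {φ : ℝ → ℝ} {x : EN n} (h : φ ‖x‖ = ‖x‖) : radMap φ x = x := by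
  by_cases hx : x = 0
  · subst hx; simp [radMap]
  · have : ‖x‖ ≠ 0 := norm_ne_zero_iff.2 hx
    simp [radMap, h, div_self this]

lemma radMap_norm {n : ℕ} {φ : ℝ → ℝ} {x : EN n} (h0 : 0 ≤ φ ‖x‖) (h : x = 0 → φ 0 = 0) :
    ‖radMap φ x‖ = φ ‖x‖ := by
  by_cases hx : x = 0
  · have := h hx
    subst hx; simp [radMap, this]
  · have : 0 < ‖x‖ := norm_pos_iff.2 hx
    rw [radMap, norm_smul, Real.norm_eq_abs, abs_of_nonneg (by positivity), div_mul_cancel₀ _ this.ne']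

lemma radMap_cont {n : ℕ} {φ : ℝ → ℝ} (hφ : Continuous φ) {δ : ℝ} (hδ : 0 < δ)
    (hid : ∀ s, s ≤ δ → φ s = s) : Continuous (radMap φ : EN n → EN n) := by
  rw [continuous_iff_continuousAt]
  intro x
  by_cases hx : x = 0
  · subst hx
    refine continuousAt_id.congr ?_
    filter_upwards [Metric.ball_mem_nhds (0 : EN n) hδ] with y hy
    exact (radMap_id (hid _ (by simpa using (mem_ball_zero_iff.1 hy).le))).symm
  · have h1 : ContinuousAt (fun x : EN n => φ ‖x‖ / ‖x‖) x :=
      (hφ.comp continuous_norm).continuousAt.div continuous_norm.continuousAt (norm_ne_zero_iff.2 hx)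
    exact h1.smul continuousAt_id

lemma radMap_comp {n : ℕ} {φ ψ : ℝ → ℝ} (h0 : φ 0 = 0) (hφ : ∀ s, 0 < s → 0 < φ s)
    (hψ : ∀ s, ψ (φ s) = s) (x : EN n) : radMap ψ (radMap φ x) = x := by
  by_cases hx : x = 0
  · subst hx; simp [radMap]
  · have hx' : 0 < ‖x‖ := norm_pos_iff.2 hx
    have h1 : ‖radMap φ x‖ = φ ‖x‖ := radMap_norm (hφ _ hx').le (fun _ => h0)
    rw [radMap, h1, hψ, radMap, smul_smul]
    have := hφ _ hx'
    rw [div_mul_div_cancel₀ this.ne', div_self hx'.ne', one_smul]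

lemma squeeze {n : ℕ} {b r ε' ε : ℝ} (h0 : 0 < ε') (h1 : ε' < ε) (h2 : ε ≤ r) (h3 : r < b) :
    ∃ t : EN n ≃ₜ EN n, (∀ x, ‖x‖ ≤ ε' → t x = x) ∧ (∀ x, b ≤ ‖x‖ → t x = x) ∧
      ∀ x, ‖x‖ ≤ r → ‖t.symm x‖ ≤ ε := by
  set s1 : ℝ := (r - ε') / (ε - ε') with hs1
  set s2 : ℝ := (b - r) / (b - ε) with hs2
  have hs1' : 1 ≤ s1 := by rw [hs1, le_div_iff₀ (by linarith)]; linarith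
  have hs2p : 0 < s2 := by rw [hs2]; apply div_pos <;> linarith
  have hs2' : s2 ≤ 1 := by rw [hs2, div_le_iff₀ (by linarith)]; linarith
  let φ : ℝ → ℝ := fun x => max x (min (ε' + s1 * (x - ε')) (b + s2 * (x - b)))
  have hmono : StrictMono φ := by
    intro x y hxy
    have ha : ε' + s1 * (x - ε') < ε' + s1 * (y - ε') := by nlinarith
    have hb : b + s2 * (x - b) < b + s2 * (y - b) := by nlinarith
    exact max_lt_max hxy (min_lt_min ha hb)
  have hcont : Continuous φ := by fun_prop
  have hlo : ∀ s, s ≤ ε' → φ s = s := by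
    intro s hs
    apply max_eq_left
    apply (min_le_left _ _).trans
    nlinarith
  have hhi : ∀ s, b ≤ s → φ s = s := by
    intro s hs
    apply max_eq_left
    apply (min_le_right _ _).trans
    nlinarith
  have hε : φ ε = r := by
    have e1 : ε' + s1 * (ε - ε') = r := by
      rw [hs1, div_mul_cancel₀ _ (by linarith)]; ring
    have e2 : b + s2 * (ε - b) = r := by
      have : s2 * (b - ε) = b - r := by rw [hs2, div_mul_cancel₀ _ (by linarith)]
      linarith
    simp only [φ, e1, e2, min_self]
    exact max_eq_right h2
  have hsurj : Function.Surjective φ := by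
    apply hcont.surjective
    · exact Filter.tendsto_atTop_mono (fun x => le_max_left _ _) Filter.tendsto_id
    · refine Filter.tendsto_id.congr' ?_
      filter_upwards [Filter.eventually_le_atBot ε'] with s hs
      exact (hlo s hs).symm
  let o := hmono.orderIsoOfSurjective φ hsurj
  have ho : ∀ s, o s = φ s := fun s => rfl
  have hlo' : ∀ s, s ≤ ε' → o.symm s = s := by
    intro s hs
    rw [o.symm_apply_eq, ho, hlo s hs]
  have hpos : ∀ s, 0 < s → 0 < φ s := by
    intro s hs
    have := hmono hs
    rwa [hlo 0 h0.le] at this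
  have hpos' : ∀ s, 0 < s → 0 < o.symm s := by
    intro s hs
    have := o.symm.strictMono hs
    rwa [hlo' 0 h0.le] at this
  refine ⟨⟨⟨radMap φ, radMap o.symm, radMap_comp (hlo 0 h0.le) hpos (fun s => o.symm_apply_apply s),
    radMap_comp (hlo' 0 h0.le) hpos' (fun s => o.apply_symm_apply s)⟩,
    radMap_cont hcont h0 hlo, radMap_cont o.symm.continuous h0 hlo'⟩, ?_, ?_, ?_⟩
  · intro x hx; exact radMap_id (hlo _ hx)
  · intro x hx; exact radMap_id (hhi _ hx)
  · intro x hx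
    have h : ‖radMap o.symm x‖ = o.symm ‖x‖ := by
      apply radMap_norm
      · rcases (norm_nonneg x).eq_or_lt with h | h
        · rw [← h, hlo' 0 h0.le]
        · exact (hpos' _ h).le
      · intro _; exact hlo' 0 h0.le
    change ‖radMap o.symm x‖ ≤ ε
    rw [h]
    rw [o.symm_apply_le, ho, hε]
    exact hx

lemma limit_homeo {Y : Type*} [TopologicalSpace Y] (Θ : ℕ → Y ≃ₜ Y) (O : ℕ → Set Y)
    (hO : ∀ k, IsOpen (O k)) (hmono : ∀ k, O k ⊆ O (k+1))
    (heq : ∀ k, ∀ x ∈ O k, Θ (k+1) x = Θ k x) :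
    ∃ e : OpenPartialHomeomorph Y Y, e.source = ⋃ k, O k ∧ e.target = ⋃ k, Θ k '' O k ∧
      ∀ k, ∀ x ∈ O k, e x = Θ k x := by
  classical
  by_cases hne : Nonempty Y
  swap
  · have : IsEmpty Y := not_nonempty_iff.1 hne
    refine ⟨OpenPartialHomeomorph.refl Y, Subsingleton.elim _ _, Subsingleton.elim _ _, fun k x => isEmptyElim x⟩
  have hM : Monotone O := monotone_nat_of_le_succ hmono
  have heq' : ∀ k j, k ≤ j → ∀ x ∈ O k, Θ j x = Θ k x := by
    intro k j hkj
    induction j, hkj using Nat.le_induction with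
    | base => intro x _; rfl
    | succ j hj ih => intro x hx; rw [heq j x (hM hj hx), ih x hx]
  let F : Y → Y := fun x => if h : ∃ k, x ∈ O k then Θ (Nat.find h) x else x
  have hF : ∀ k, ∀ x ∈ O k, F x = Θ k x := by
    intro k x hx
    have h : ∃ k, x ∈ O k := ⟨k, hx⟩
    simp only [F, dif_pos h]
    exact (heq' _ _ (Nat.find_min' h hx) x (Nat.find_spec h)).symm
  have hinj : InjOn F (⋃ k, O k) := by
    intro x hx y hy hxy
    obtain ⟨i, hi⟩ := mem_iUnion.1 hx
    obtain ⟨j, hj⟩ := mem_iUnion.1 hy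
    have hi' := hM (le_max_left i j) hi
    have hj' := hM (le_max_right i j) hj
    rw [hF _ x hi', hF _ y hj'] at hxy
    exact (Θ _).injective hxy
  have hU : IsOpen (⋃ k, O k) := isOpen_iUnion hO
  have himg : ∀ S : Set Y, F '' (S ∩ ⋃ k, O k) = ⋃ k, Θ k '' (S ∩ O k) := by
    intro S
    rw [inter_iUnion, image_iUnion]
    refine iUnion_congr fun k => ?_
    exact image_congr fun x hx => hF k x hx.2
  have hc : ContinuousOn F (⋃ k, O k) := by
    intro x hx
    obtain ⟨i, hi⟩ := mem_iUnion.1 hx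
    apply ContinuousAt.continuousWithinAt
    refine (Θ i).continuous.continuousAt.congr ?_
    filter_upwards [(hO i).mem_nhds hi] with y hy
    exact (hF i y hy).symm
  let pe := hinj.toPartialEquiv F (⋃ k, O k)
  have hs : pe.source = ⋃ k, O k := rfl
  refine ⟨OpenPartialHomeomorph.ofContinuousOpenRestrict pe hc ?_ hU, rfl, ?_, hF⟩
  · intro S hS
    have : pe.source.domRestrict pe '' S = F '' ((Subtype.val '' S) ∩ ⋃ k, O k) := by
      ext y
      constructor
      · rintro ⟨x, hx, rfl⟩
        exact ⟨x, ⟨⟨x, hx, rfl⟩, x.2⟩, rfl⟩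
      · rintro ⟨x, ⟨⟨z, hz, rfl⟩, _⟩, rfl⟩
        exact ⟨z, hz, rfl⟩
    rw [this, himg]
    refine isOpen_iUnion fun k => (Θ k).isOpenMap _ (IsOpen.inter ?_ (hO k))
    exact hU.isOpenMap_subtype_val S hS
  · have := himg univ
    simp only [univ_inter] at this
    exact this


/-! ### Chart balls and the two exhaustion lemmas -/

lemma exists_seq_step {α : Type*} (P : ℕ → α → Prop) (R : ℕ → α → α → Prop) (a0 : α) (h0 : P 0 a0)
    (hs : ∀ k a, P k a → ∃ a', P (k+1) a' ∧ R k a a') :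
    ∃ u : ℕ → α, u 0 = a0 ∧ (∀ k, P k (u k)) ∧ ∀ k, R k (u k) (u (k+1)) := by
  choose nx h1 h2 using hs
  let v : ∀ k, {a // P k a} := fun k => Nat.rec ⟨a0, h0⟩ (fun k a => ⟨nx k a.1 a.2, h1 k a.1 a.2⟩) k
  exact ⟨fun k => (v k).1, rfl, fun k => (v k).2, fun k => h2 k _ (v k).2⟩

section charts

variable {n : ℕ} {Y : Type*} [TopologicalSpace Y]

def cB (c : EN n → Y) (r : ℝ) : Set Y := c '' Metric.closedBall 0 r
def cO (c : EN n → Y) (r : ℝ) : Set Y := c '' Metric.ball 0 r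

lemma cO_sub_cB (c : EN n → Y) (r : ℝ) : cO c r ⊆ cB c r := image_mono Metric.ball_subset_closedBall
lemma cB_sub_cO (c : EN n → Y) {r s : ℝ} (h : r < s) : cB c r ⊆ cO c s :=
  image_mono (Metric.closedBall_subset_ball h)
lemma cB_mono (c : EN n → Y) {r s : ℝ} (h : r ≤ s) : cB c r ⊆ cB c s :=
  image_mono (Metric.closedBall_subset_closedBall h)
lemma cO_mono (c : EN n → Y) {r s : ℝ} (h : r ≤ s) : cO c r ⊆ cO c s :=
  image_mono (Metric.ball_subset_ball h)
lemma cB_zero (c : EN n → Y) {r : ℝ} (h : 0 ≤ r) : c 0 ∈ cB c r := ⟨0, by simpa using h, rfl⟩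
lemma cO_zero (c : EN n → Y) {r : ℝ} (h : 0 < r) : c 0 ∈ cO c r := ⟨0, by simpa using h, rfl⟩

lemma cO_open {c : EN n → Y} (hc : IsOpenEmbedding c) (r : ℝ) : IsOpen (cO c r) :=
  hc.isOpenMap _ Metric.isOpen_ball
lemma cB_compact {c : EN n → Y} (hc : IsOpenEmbedding c) (r : ℝ) : IsCompact (cB c r) :=
  (isCompact_closedBall _ _).image hc.continuous

lemma cB_small {c : EN n → Y} (hc : IsOpenEmbedding c) {U : Set Y} (hU : IsOpen U) (h0 : c 0 ∈ U)
    {s : ℝ} (hs : 0 < s) : ∃ δ, 0 < δ ∧ δ ≤ s ∧ cB c δ ⊆ U := by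
  obtain ⟨δ, hδ, h⟩ := Metric.nhds_basis_closedBall.mem_iff.1 ((hU.preimage hc.continuous).mem_nhds h0)
  refine ⟨min δ s, lt_min hδ hs, min_le_right _ _, ?_⟩
  rintro _ ⟨x, hx, rfl⟩
  exact h (Metric.closedBall_subset_closedBall (min_le_left _ _) hx)

lemma cO_shrink {c : EN n → Y} (hc : IsOpenEmbedding c) {K : Set Y} (hK : IsCompact K) {r s : ℝ}
    (hKr : K ⊆ cO c r) (hs : s < r) : ∃ r', s < r' ∧ r' < r ∧ K ⊆ cO c r' := by
  have hK' : IsCompact (c ⁻¹' K) := by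
    apply hc.isInducing.isCompact_preimage' hK
    exact hKr.trans (image_subset_range _ _)
  rcases (c ⁻¹' K).eq_empty_or_nonempty with he | hne
  · refine ⟨(s + r)/2, by linarith, by linarith, ?_⟩
    intro x hx
    obtain ⟨y, _, rfl⟩ := hKr hx
    exact absurd hx (by simpa using (he.le : c ⁻¹' K ⊆ ∅) (a := y))
  · obtain ⟨y, hy, hmax⟩ := hK'.exists_isMaxOn hne continuous_norm.continuousOn
    obtain ⟨y', hy', e⟩ := hKr hy
    have : ‖y‖ < r := by rw [← hc.injective e]; simpa using hy'
    have hlt : max s ‖y‖ < r := max_lt hs this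
    have h1 := le_max_left s ‖y‖
    have h2 := le_max_right s ‖y‖
    refine ⟨(max s ‖y‖ + r)/2, by linarith, by linarith, ?_⟩
    intro x hx
    obtain ⟨z, _, rfl⟩ := hKr hx
    have h3 : ‖z‖ ≤ ‖y‖ := hmax hx
    refine ⟨z, ?_, rfl⟩
    rw [mem_ball_zero_iff]; linarith

lemma cB_iUnion (c : EN n → Y) {ρ : ℕ → ℝ} {d : ℝ} (hρ : Filter.Tendsto ρ Filter.atTop (𝓝 d)) {x : Y}
    (hx : x ∈ cO c d) : ∃ k, x ∈ cO c (ρ k) := by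
  obtain ⟨y, hy, rfl⟩ := hx
  obtain ⟨k, hk⟩ := (hρ.eventually (lt_mem_nhds (mem_ball_zero_iff.1 hy))).exists
  exact ⟨k, y, by simpa using hk, rfl⟩

lemma cB_iInter {c : EN n → Y} (hc : IsOpenEmbedding c) {ρ : ℕ → ℝ}
    (hρ : Filter.Tendsto ρ Filter.atTop (𝓝 0)) {x : Y}
    (hx : x ≠ c 0) : ∃ k, x ∉ cB c (ρ k) := by
  by_contra! h
  obtain ⟨y, _, rfl⟩ := h 0
  have hy : y ≠ 0 := fun h => hx (by rw [h])
  obtain ⟨k, hk⟩ := (hρ.eventually (gt_mem_nhds (norm_pos_iff.2 hy))).exists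
  obtain ⟨z, hz, e⟩ := h k
  rw [hc.injective e, mem_closedBall_zero_iff] at hz
  linarith

lemma chart_squeeze [T2Space Y] {c : EN n → Y} (hc : IsOpenEmbedding c) {b r ε' ε : ℝ}
    (h0 : 0 < ε') (h1 : ε' < ε) (h2 : ε ≤ r) (h3 : r < b) :
    ∃ t : Y ≃ₜ Y, (∀ x ∈ cB c ε', t x = x) ∧ (∀ x, x ∉ cO c b → t x = x) ∧
      ∀ x ∈ cB c r, t.symm x ∈ cB c ε := by
  obtain ⟨t, ht1, ht2, ht3⟩ := squeeze (n := n) h0 h1 h2 h3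
  obtain ⟨T, hT1, hT2⟩ := ext_homeo hc t (isCompact_closedBall 0 b) (by
    intro y hy
    rw [mem_closedBall_zero_iff, not_le] at hy
    exact ht2 y hy.le)
  refine ⟨T, ?_, ?_, ?_⟩
  · rintro _ ⟨x, hx, rfl⟩
    rw [hT1, ht1 x (by simpa using hx)]
  · intro x hx
    by_cases h : x ∈ c '' Metric.closedBall 0 b
    · obtain ⟨y, hy, rfl⟩ := h
      rw [hT1, ht2 y]
      by_contra h'
      exact hx ⟨y, by simpa using h', rfl⟩
    · exact hT2 x h
  · rintro _ ⟨x, hx, rfl⟩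
    refine ⟨t.symm x, by simpa using ht3 x (by simpa using hx), ?_⟩
    rw [T.eq_symm_apply, hT1, t.apply_symm_apply]

/-- a homeomorphism fixing everything outside `S` preserves `S` -/
lemma maps_of_fix {t : Y ≃ₜ Y} {S : Set Y} (h : ∀ x, x ∉ S → t x = x) {x : Y} : t x ∈ S ↔ x ∈ S := by
  constructor
  · intro hx
    by_contra h'
    rw [h x h'] at hx
    exact h' hx
  · intro hx
    by_contra h'
    have := t.injective (h _ h')
    rw [this] at h'
    exact h' hx

lemma pow_succ_app (g : Y ≃ₜ Y) (k : ℕ) (x : Y) : (g ^ (k+1)) x = (g ^ k) (g x) := by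
  rw [pow_succ]; rfl
lemma pow_succ_app' (g : Y ≃ₜ Y) (k : ℕ) (x : Y) : (g ^ (k+1)) x = g ((g ^ k) x) := by
  rw [pow_succ']; rfl
lemma pow_fix (g : Y ≃ₜ Y) {p : Y} (hp : g p = p) (k : ℕ) : (g ^ k) p = p := by
  induction k with
  | zero => rfl
  | succ k ih => rw [pow_succ_app, hp, ih]
lemma pow_maps (g : Y ≃ₜ Y) {S : Set Y} (hg : ∀ x ∈ S, g x ∈ S) (k : ℕ) : ∀ x ∈ S, (g ^ k) x ∈ S := by
  induction k with
  | zero => intro x hx; exact hx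
  | succ k ih => intro x hx; rw [pow_succ_app]; exact ih _ (hg x hx)

lemma lemA [T2Space Y] {c : EN n → Y} (hc : IsOpenEmbedding c) (g : Y ≃ₜ Y) (hp : g (c 0) = c 0)
    {b : ℝ} (hb : 0 < b) (hg : ∀ x ∈ cB c b, g x ∈ cO c b) :
    Nonempty (↥(cB c b \ {x | ∀ j : ℕ, (g ^ j).symm x ∈ cB c b}) ≃ₜ
      ↥(Metric.closedBall (0 : EN n) b \ {0})) := by
  have hgB : ∀ k, ∀ x ∈ cB c b, (g ^ k) x ∈ cB c b :=
    pow_maps g (fun x hx => cO_sub_cB c b (hg x hx))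
  obtain ⟨r, hr0, hrb, hr⟩ : ∃ r, 0 < r ∧ r < b ∧ ∀ x ∈ cB c b, g x ∈ cB c r := by
    obtain ⟨r, h1, h2, h3⟩ := cO_shrink hc ((cB_compact hc b).image g.continuous)
      (by rintro _ ⟨x, hx, rfl⟩; exact hg x hx) hb
    exact ⟨r, h1, h2, fun x hx => cO_sub_cB c r (h3 ⟨x, hx, rfl⟩)⟩
  obtain ⟨u, hu0, hP, hR⟩ := exists_seq_step
    (P := fun k (a : (Y ≃ₜ Y) × ℝ) => 0 < a.2 ∧ a.1 (c 0) = c 0 ∧ (∀ x, x ∉ cB c b → a.1 x = x) ∧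
      ∀ x ∈ cB c b, a.1.symm ((g ^ k) x) ∈ cO c a.2)
    (R := fun k a a' => a'.2 ≤ a.2 / 2 ∧ (∀ x, x ∉ cO c a.2 → a'.1 x = a.1 x) ∧
      ∀ x ∈ cB c a'.2, (g ^ k).symm (a'.1 x) ∈ cB c b)
    (a0 := (1, b + 1))
    ⟨by simp; linarith, rfl, fun _ _ => rfl, fun x hx => cB_sub_cO c (by simp) hx⟩
    (by
      rintro k ⟨Θ, ρ⟩ ⟨hρ, hΘp, hΘid, hΘ⟩
      dsimp only at *
      have hgp := pow_fix g hp k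
      have hgp' : (g ^ k).symm (c 0) = c 0 := by rw [Homeomorph.symm_apply_eq, hgp]
      have hΘp' : Θ.symm (c 0) = c 0 := by rw [Homeomorph.symm_apply_eq, hΘp]
      obtain ⟨ρ', hρ'0, hρ', hρ's⟩ := cB_small hc
        (U := (fun x => (g ^ k).symm (Θ x)) ⁻¹' cO c b)
        ((cO_open hc b).preimage (by fun_prop)) (by
          simp only [mem_preimage, hΘp, hgp']; exact cO_zero c hb) (half_pos hρ)
      obtain ⟨ε, hε0, hε, hεs⟩ := cB_small hc
        (U := (fun x => Θ.symm ((g ^ k) x)) ⁻¹' cO c ρ')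
        ((cO_open hc ρ').preimage (by fun_prop)) (by
          simp only [mem_preimage, hgp, hΘp']; exact cO_zero c hρ'0) hr0
      obtain ⟨t, ht1, ht2, ht3⟩ := chart_squeeze hc (half_pos hε0) (half_lt_self hε0) hε hrb
      have ht2' : ∀ x, x ∉ cB c b → t x = x := fun x hx => ht2 x (fun h => hx (cO_sub_cB c b h))
      refine ⟨(((Θ.trans (g ^ k).symm).trans t).trans (g ^ k), ρ'), ⟨hρ'0, ?_, ?_, ?_⟩, hρ', ?_, ?_⟩
      · simp only [Homeomorph.trans_apply, hΘp, hgp', ht1 _ (cB_zero c (half_pos hε0).le), hgp]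
      · intro x hx
        simp only [Homeomorph.trans_apply]
        rw [hΘid x hx, ht2', Homeomorph.apply_symm_apply]
        intro h
        apply hx
        simpa using hgB k _ h
      · intro x hx
        simp only [Homeomorph.symm_trans_apply, Homeomorph.symm_symm, pow_succ_app,
          Homeomorph.symm_apply_apply]
        exact hεs (ht3 _ (hr x hx))
      · intro x hx
        simp only [Homeomorph.trans_apply]
        rw [ht2', Homeomorph.apply_symm_apply]
        intro h
        apply hx
        simpa using hΘ _ h
      · intro x hx
        simp only [Homeomorph.trans_apply, Homeomorph.symm_apply_apply]
        rw [maps_of_fix ht2']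
        exact cO_sub_cB c b (hρ's hx))
  have hρ0 : ∀ k, 0 < (u k).2 := fun k => (hP k).1
  have hρlim : Filter.Tendsto (fun k => (u k).2) Filter.atTop (𝓝 0) := by
    have : ∀ k, (u k).2 ≤ (b + 1) * (1/2)^k := by
      intro k
      induction k with
      | zero => simp [hu0]
      | succ k ih => have := (hR k).1; rw [pow_succ]; linarith
    refine squeeze_zero (fun k => (hρ0 k).le) this ?_
    simpa using (tendsto_pow_atTop_nhds_zero_of_lt_one (r := (1/2 : ℝ)) (by norm_num) (by norm_num)).const_mul (b+1)
  obtain ⟨e, hes, het, heq⟩ := limit_homeo (fun k => (u k).1) (fun k => (cB c (u k).2)ᶜ)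
    (fun k => (cB_compact hc _).isClosed.isOpen_compl)
    (fun k => compl_subset_compl.2 (cB_mono c (by have := (hR k).1; have := hρ0 k; linarith)))
    (fun k x hx => (hR k).2.1 x (fun h => hx (cO_sub_cB c _ h)))
  have hsrc : ∀ x, x ∈ e.source ↔ x ≠ c 0 := by
    intro x
    rw [hes, mem_iUnion]
    constructor
    · rintro ⟨k, hk⟩ rfl
      exact hk (cB_zero c (hρ0 k).le)
    · intro h
      exact cB_iInter hc hρlim h
  have htgt : ∀ x, x ∈ e.target ↔ ¬ ∀ j : ℕ, (g ^ j).symm x ∈ cB c b := by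
    intro x
    rw [het, mem_iUnion]
    constructor
    · rintro ⟨k, y, hy, rfl⟩ h
      apply hy
      have := (hP k).2.2.2 _ (h k)
      simp only [Homeomorph.apply_symm_apply, Homeomorph.symm_apply_apply] at this
      exact cO_sub_cB c _ this
    · intro h
      push Not at h
      obtain ⟨k, hk⟩ := h
      refine ⟨k+1, (u (k+1)).1.symm x, ?_, by simp⟩
      intro h
      apply hk
      simpa using (hR k).2.2 _ h
  have heB : ∀ x ∈ e.source, (e x ∈ cB c b ↔ x ∈ cB c b) := by
    intro x hx
    rw [hes, mem_iUnion] at hx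
    obtain ⟨k, hk⟩ := hx
    rw [heq k x hk, maps_of_fix (hP k).2.2.1]
  have him : e '' (c '' (Metric.closedBall 0 b \ {0})) = cB c b \ {x | ∀ j : ℕ, (g ^ j).symm x ∈ cB c b} := by
    ext y
    constructor
    · rintro ⟨_, ⟨x, ⟨hx, hx0⟩, rfl⟩, rfl⟩
      have hs : c x ∈ e.source := (hsrc _).2 (fun h => hx0 (hc.injective h))
      exact ⟨(heB _ hs).2 ⟨x, hx, rfl⟩, (htgt _).1 (e.map_source hs)⟩
    · rintro ⟨hy, hy'⟩
      have ht := (htgt y).2 hy'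
      have hs := e.map_target ht
      have := heB _ hs
      rw [e.right_inv ht] at this
      obtain ⟨x, hx, hxe⟩ := this.1 hy
      refine ⟨_, ⟨x, ⟨hx, ?_⟩, rfl⟩, ?_⟩
      · rintro rfl
        exact (hsrc _).1 hs hxe.symm
      · rw [hxe, e.right_inv ht]
  have hss : c '' (Metric.closedBall 0 b \ {0}) ⊆ e.source := by
    rintro _ ⟨x, ⟨hx, hx0⟩, rfl⟩
    exact (hsrc _).2 (fun h => hx0 (hc.injective h))
  exact ⟨((hc.isEmbedding.homeomorphImage _).trans (e.homeomorphOfImageSubsetSource hss him)).symm⟩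

end charts


section chartsR

variable {n : ℕ} {Y : Type*} [TopologicalSpace Y]

lemma pow_symm_succ (g : Y ≃ₜ Y) (k : ℕ) (x : Y) : (g ^ (k+1)).symm x = g.symm ((g ^ k).symm x) := by
  rw [Homeomorph.symm_apply_eq, pow_succ_app]; simp

lemma pow_symm_maps (g : Y ≃ₜ Y) {S : Set Y} (hg : ∀ x ∈ S, g.symm x ∈ S) {j k : ℕ} (hjk : j ≤ k) {x : Y}
    (hx : (g ^ j).symm x ∈ S) : (g ^ k).symm x ∈ S := by
  induction k, hjk using Nat.le_induction with
  | base => exact hx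
  | succ k hk ih => rw [pow_symm_succ]; exact hg _ ih

lemma repel_absorb {S : Set Y} (g : Y ≃ₜ Y) {O : Set Y} (hO : IsOpen O)
    (hg : ∀ x ∈ O, g.symm x ∈ O) (hS : IsCompact S) (h : ∀ x ∈ S, ∃ j : ℕ, (g ^ j).symm x ∈ O) (k : ℕ) :
    ∃ j, k ≤ j ∧ ∀ x ∈ S, (g ^ j).symm x ∈ O := by
  obtain ⟨i, hi⟩ := hS.elim_directed_cover (fun j : ℕ => (g ^ j).symm ⁻¹' O)
    (fun j => hO.preimage (g ^ j).symm.continuous)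
    (fun x hx => mem_iUnion.2 (h x hx))
    (directed_of_isDirected_le (fun i j hij x hx => pow_symm_maps g hg hij hx))
  exact ⟨max k i, le_max_left _ _, fun x hx => pow_symm_maps g hg (le_max_right _ _) (hi hx)⟩

lemma lemR [T2Space Y] {c : EN n → Y} (hc : IsOpenEmbedding c) (g : Y ≃ₜ Y) (hp : g (c 0) = c 0)
    {a d : ℝ} (ha : 0 < a) (had : a < d) (hg : ∀ x ∈ cB c d, g.symm x ∈ cO c d) :
    Nonempty (↥({x | ∃ j : ℕ, (g ^ j).symm x ∈ cB c d} \ cO c a) ≃ₜ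
      ↥(Metric.ball (0 : EN n) d \ Metric.ball 0 a)) := by
  set R : Set Y := {x | ∃ j : ℕ, (g ^ j).symm x ∈ cB c d} with hRdef
  have hd : 0 < d := ha.trans had
  have hgO : ∀ x ∈ cO c d, g.symm x ∈ cO c d := fun x hx => hg x (cO_sub_cB c d hx)
  have hgB : ∀ x ∈ cB c d, g.symm x ∈ cB c d := fun x hx => cO_sub_cB c d (hg x hx)
  have hRO : ∀ x ∈ R, ∃ j : ℕ, (g ^ j).symm x ∈ cO c d := by
    rintro x ⟨j, hj⟩
    exact ⟨j + 1, by rw [pow_symm_succ]; exact hg _ hj⟩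
  have hZc : IsCompact (g.symm '' cB c d) := (cB_compact hc d).image g.symm.continuous
  have hZO : g.symm '' cB c d ⊆ cO c d := by
    rintro _ ⟨x, hx, rfl⟩; exact hg x hx
  obtain ⟨r, hr0, hrd, hr⟩ := cO_shrink hc hZc hZO hd
  obtain ⟨ρ0, hρ0a, hρ0d, hρ0⟩ := cO_shrink hc hZc hZO had
  obtain ⟨u, hu0, hP, hR⟩ := exists_seq_step
    (P := fun k (q : (Y ≃ₜ Y) × ℝ) => a < q.2 ∧ q.2 < d ∧ q.1 (c 0) = c 0 ∧ (∀ x ∈ cB c d, q.1 x ∈ R) ∧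
      ∀ x ∈ cB c d, q.1.symm ((g ^ k) (g.symm x)) ∈ cO c q.2)
    (R := fun k q q' => (q.2 + d) / 2 ≤ q'.2 ∧ (∀ x ∈ cO c q.2, q'.1 x = q.1 x))
    (a0 := (1, ρ0))
    ⟨hρ0a, hρ0d, rfl, fun x hx => ⟨0, hx⟩, fun x hx => hρ0 ⟨x, hx, rfl⟩⟩
    (by
      rintro k ⟨Θ, ρ⟩ ⟨hρa, hρd, hΘp, hΘR, hΘ⟩
      dsimp only at *
      have hρ : 0 < ρ := ha.trans hρa
      obtain ⟨j, hkj, hj⟩ := repel_absorb (S := Θ '' cB c d) g (cO_open hc d) hgO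
        ((cB_compact hc d).image Θ.continuous)
        (by rintro _ ⟨x, hx, rfl⟩; exact hRO _ (hΘR x hx)) k
      have hj' : ∀ x ∈ cB c d, (g ^ j).symm (Θ x) ∈ cO c d := fun x hx => hj _ ⟨x, hx, rfl⟩
      set m := j + 1 with hm
      have hgp := pow_fix g hp m
      have hgp' : (g ^ m).symm (c 0) = c 0 := by rw [Homeomorph.symm_apply_eq, hgp]
      have hΘp' : Θ.symm (c 0) = c 0 := by rw [Homeomorph.symm_apply_eq, hΘp]
      obtain ⟨ε, hε0, hε, hεs⟩ := cB_small hc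
        (U := (fun x => Θ.symm ((g ^ m) x)) ⁻¹' cO c d)
        ((cO_open hc d).preimage (by fun_prop)) (by
          simp only [mem_preimage, hgp, hΘp']; exact cO_zero c hd) hr0
      obtain ⟨η, hη0, hη, hηs⟩ := cB_small hc
        (U := (fun x => (g ^ m).symm (Θ x)) ⁻¹' cO c (ε / 2))
        ((cO_open hc _).preimage (by fun_prop)) (by
          simp only [mem_preimage, hΘp, hgp']; exact cO_zero c (half_pos hε0)) hρ
      obtain ⟨t, ht1, ht2, ht3⟩ := chart_squeeze hc (half_pos hη0) (half_lt_self hη0) hη hρd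
      obtain ⟨s, hs1, hs2, hs3⟩ := chart_squeeze hc (half_pos hε0) (half_lt_self hε0) hε hrd
      have ht2' : ∀ x, x ∉ cB c d → t x = x := fun x hx => ht2 x (fun h => hx (cO_sub_cB c d h))
      have htB : ∀ x ∈ cB c d, t.symm x ∈ cB c d := by
        intro x hx
        rw [← maps_of_fix ht2', t.apply_symm_apply]; exact hx
      have htO : ∀ x ∈ cO c d, t x ∈ cO c d := fun x hx => (maps_of_fix ht2).2 hx
      let Θ' : Y ≃ₜ Y := ((((((t.symm.trans Θ).trans (g ^ m).symm).trans s).trans (g ^ m)).trans Θ.symm).trans t).trans Θ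
      have hΘ' : ∀ x, Θ' x = Θ (t (Θ.symm ((g ^ m) (s ((g ^ m).symm (Θ (t.symm x))))))) := fun x => rfl
      have hΘs : ∀ x, Θ'.symm x = t (Θ.symm ((g ^ m) (s.symm ((g ^ m).symm (Θ (t.symm (Θ.symm x))))))) :=
        fun x => rfl
      have heqρ : ∀ x ∈ cB c ρ, Θ' x = Θ x := by
        intro x hx
        rw [hΘ', hs1 _ (cO_sub_cB c _ (hηs (ht3 x hx)))]
        simp
      have hR' : ∀ x ∈ cB c d, Θ' x ∈ R := by
        intro x hx
        rw [hΘ']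
        have h1 := hj' _ (htB x hx)
        have h2 : (g ^ m).symm (Θ (t.symm x)) ∈ cO c d := by
          rw [hm, pow_symm_succ]; exact hgO _ h1
        have h3 : s ((g ^ m).symm (Θ (t.symm x))) ∈ cO c d := (maps_of_fix hs2).2 h2
        set w := (g ^ m) (s ((g ^ m).symm (Θ (t.symm x)))) with hw
        by_cases h4 : Θ.symm w ∈ cO c d
        · exact hΘR _ (cO_sub_cB c d (htO _ h4))
        · rw [ht2 _ h4, Θ.apply_symm_apply]
          exact ⟨m, by rw [hw, Homeomorph.symm_apply_apply]; exact cO_sub_cB c d h3⟩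
      have hnew : ∀ x ∈ cB c d, Θ'.symm ((g ^ (k+1)) (g.symm x)) ∈ cO c d := by
        intro x hx
        rw [hΘs]
        apply htO
        rw [pow_succ_app g k, g.apply_symm_apply]
        -- the conjugated squeeze fixes everything outside `g^j B`
        have h1 : ∀ y, y ∉ (g ^ j).symm ⁻¹' cB c d → ((Θ.symm.trans t.symm).trans Θ) y = y := by
          intro y hy
          simp only [Homeomorph.trans_apply]
          have : Θ.symm y ∉ cB c d := by
            intro h
            apply hy
            have := hj' _ h
            rw [Θ.apply_symm_apply] at this
            exact cO_sub_cB c d this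
          have h' : t.symm (Θ.symm y) = Θ.symm y := by
            rw [t.symm_apply_eq, ht2' _ this]
          rw [h', Θ.apply_symm_apply]
        have h2 : (g ^ k) x ∈ (g ^ j).symm ⁻¹' cB c d := by
          apply pow_symm_maps g hgB hkj
          simpa using hx
        have h3 := (maps_of_fix h1).2 h2
        simp only [Homeomorph.trans_apply, mem_preimage] at h3
        have h4 : (g ^ m).symm (Θ (t.symm (Θ.symm ((g ^ k) x)))) ∈ cB c r := by
          rw [hm, pow_symm_succ]
          exact cO_sub_cB c _ (hr ⟨_, h3, rfl⟩)
        exact hεs (hs3 _ h4)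
      have hp' : Θ' (c 0) = c 0 := by rw [heqρ _ (cB_zero c hρ.le), hΘp]
      obtain ⟨ρ', h1, h2, h3⟩ := cO_shrink hc (s := (ρ + d)/2) (r := d)
        (K := (fun x => Θ'.symm ((g ^ (k+1)) (g.symm x))) '' cB c d)
        ((cB_compact hc d).image (by fun_prop))
        (by rintro _ ⟨x, hx, rfl⟩; exact hnew x hx) (by linarith)
      exact ⟨(Θ', ρ'), ⟨by dsimp only; linarith, h2, hp', hR', fun x hx => h3 ⟨x, hx, rfl⟩⟩, h1.le,
        fun x hx => heqρ x (cO_sub_cB c ρ hx)⟩)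
  have hρd : ∀ k, (u k).2 < d := fun k => (hP k).2.1
  have hρlim : Filter.Tendsto (fun k => (u k).2) Filter.atTop (𝓝 d) := by
    have : ∀ k, d - (u k).2 ≤ (d - ρ0) * (1/2)^k := by
      intro k
      induction k with
      | zero => simp [hu0]
      | succ k ih => have := (hR k).1; rw [pow_succ]; linarith
    have h0 : Filter.Tendsto (fun k => d - (u k).2) Filter.atTop (𝓝 0) := by
      refine squeeze_zero (fun k => by have := hρd k; linarith) this ?_
      simpa using (tendsto_pow_atTop_nhds_zero_of_lt_one (r := (1/2 : ℝ)) (by norm_num) (by norm_num)).const_mul (d - ρ0)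
    simpa using h0.const_sub d
  obtain ⟨e, hes, het, heq⟩ := limit_homeo (fun k => (u k).1) (fun k => cO c (u k).2)
    (fun k => cO_open hc _)
    (fun k => cO_mono c (by have := (hR k).1; have := hρd k; linarith))
    (fun k x hx => (hR k).2 x hx)
  have hsrc : e.source = cO c d := by
    rw [hes]
    apply Subset.antisymm
    · exact iUnion_subset fun k => cO_mono c (hρd k).le
    · intro x hx
      exact mem_iUnion.2 (cB_iUnion c hρlim hx)
  have htgt : e.target = R := by
    rw [het]
    apply Subset.antisymm
    · refine iUnion_subset fun k => ?_
      rintro _ ⟨x, hx, rfl⟩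
      exact (hP k).2.2.2.1 x (cO_sub_cB c d (cO_mono c (hρd k).le hx))
    · rintro x ⟨j, hj⟩
      refine mem_iUnion.2 ⟨j + 1, (u (j+1)).1.symm x, ?_, by simp⟩
      have := (hP (j+1)).2.2.2.2 _ hj
      rwa [pow_succ_app, g.apply_symm_apply, Homeomorph.apply_symm_apply] at this
  have hid : ∀ x ∈ cO c a, e x = x := by
    intro x hx
    have h1 : x ∈ cO c (u 0).2 := by rw [hu0]; exact cO_mono c hρ0a.le hx
    rw [heq 0 x h1, hu0]; rfl
  have haO : cO c a ⊆ e.source := by rw [hsrc]; exact cO_mono c had.le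
  have hss : c '' (Metric.ball 0 d \ Metric.ball 0 a) ⊆ e.source := by
    rw [hsrc]; exact image_mono sdiff_subset
  have him : e '' (c '' (Metric.ball 0 d \ Metric.ball 0 a)) = R \ cO c a := by
    have h1 : c '' (Metric.ball 0 d \ Metric.ball 0 a) = cO c d \ cO c a := image_sdiff hc.injective _ _
    rw [h1]
    ext y
    constructor
    · rintro ⟨x, ⟨hx, hxa⟩, rfl⟩
      have hs : x ∈ e.source := by rw [hsrc]; exact hx
      refine ⟨by rw [← htgt]; exact e.map_source hs, fun h => ?_⟩
      have := e.injOn (haO h) hs (hid _ h)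
      exact hxa (this ▸ h)
    · rintro ⟨hy, hya⟩
      rw [← htgt] at hy
      refine ⟨e.symm y, ⟨by rw [← hsrc]; exact e.map_target hy, fun h => hya ?_⟩, e.right_inv hy⟩
      have := hid _ h
      rw [e.right_inv hy] at this
      rwa [this]
  exact ⟨((hc.isEmbedding.homeomorphImage _).trans (e.homeomorphOfImageSubsetSource hss him)).symm⟩

end chartsR


/-! ### Explicit homeomorphisms and the spine -/

def shell (n : ℕ) (J : Set ℝ) : Set (EN n) := {x | ‖x‖ ∈ J}

noncomputable def shellHomeo (n : ℕ) {J : Set ℝ} (hJ : ∀ t ∈ J, 0 < t) {s : ℝ} (hs : 0 < s) :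
    ↥(shell n J) ≃ₜ ↥(Metric.sphere (0 : EN n) s) × ↥J where
  toFun x := (⟨(s / ‖(x : EN n)‖) • (x : EN n), by
    have := hJ _ x.2
    rw [mem_sphere_zero_iff_norm, norm_smul, Real.norm_eq_abs, abs_of_pos (by positivity),
      div_mul_cancel₀ _ this.ne']⟩, ⟨‖(x : EN n)‖, x.2⟩)
  invFun y := ⟨((y.2 : ℝ) / s) • (y.1 : EN n), by
    have h1 := hJ _ y.2.2
    have h2 : ‖(y.1 : EN n)‖ = s := mem_sphere_zero_iff_norm.1 y.1.2
    change ‖_‖ ∈ J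
    rw [norm_smul, Real.norm_eq_abs, abs_of_pos (by positivity), h2, div_mul_cancel₀ _ hs.ne']
    exact y.2.2⟩
  left_inv x := by
    have := hJ _ x.2
    apply Subtype.ext
    simp only [smul_smul]
    rw [div_mul_div_cancel₀ hs.ne', div_self this.ne', one_smul]
  right_inv y := by
    have h1 := hJ _ y.2.2
    have h2 : ‖(y.1 : EN n)‖ = s := mem_sphere_zero_iff_norm.1 y.1.2
    have h3 : ‖((y.2 : ℝ) / s) • (y.1 : EN n)‖ = y.2 := by
      rw [norm_smul, Real.norm_eq_abs, abs_of_pos (by positivity), h2, div_mul_cancel₀ _ hs.ne']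
    apply Prod.ext
    · apply Subtype.ext
      simp only [h3, smul_smul]
      rw [div_mul_div_cancel₀ h1.ne', div_self hs.ne', one_smul]
    · exact Subtype.ext h3
  continuous_toFun := by
    apply Continuous.prodMk
    · refine Continuous.subtype_mk ?_ _
      have h : Continuous fun x : ↥(shell n J) => s / ‖(x : EN n)‖ :=
        continuous_const.div (by fun_prop) (fun x => (hJ _ x.2).ne')
      fun_prop
    · exact Continuous.subtype_mk (by fun_prop) _
  continuous_invFun := by
    refine Continuous.subtype_mk ?_ _
    fun_prop

noncomputable def iocHomeo {b : ℝ} (hb : 0 < b) : ↥(Ioc 0 b) ≃ₜ ↥(Ici (0:ℝ)) where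
  toFun t := ⟨b / t - 1, by
    have := t.2.1
    have := t.2.2
    rw [mem_Ici, sub_nonneg, le_div_iff₀ t.2.1]; linarith⟩
  invFun u := ⟨b / (u + 1), by
    have : 0 ≤ (u : ℝ) := u.2
    constructor
    · positivity
    · rw [div_le_iff₀ (by positivity)]; nlinarith⟩
  left_inv t := by
    apply Subtype.ext
    simp only [sub_add_cancel]
    rw [div_div_cancel₀ hb.ne']
  right_inv u := by
    have : 0 ≤ (u : ℝ) := u.2
    apply Subtype.ext
    simp only []
    field_simp
    ring
  continuous_toFun := by
    refine Continuous.subtype_mk ?_ _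
    exact (continuous_const.div (by fun_prop) (fun t => t.2.1.ne')).sub continuous_const
  continuous_invFun := by
    refine Continuous.subtype_mk ?_ _
    exact continuous_const.div (by fun_prop) (fun u => by have : 0 ≤ (u : ℝ) := u.2; positivity)

noncomputable def icoHomeo {a d : ℝ} (had : a < d) : ↥(Ico a d) ≃ₜ ↥(Ici (0:ℝ)) where
  toFun t := ⟨(t - a) / (d - t), by
    have := t.2.1
    have := t.2.2
    rw [mem_Ici]; apply div_nonneg <;> linarith⟩
  invFun u := ⟨(a + u * d) / (1 + u), by
    have : 0 ≤ (u : ℝ) := u.2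
    constructor
    · rw [le_div_iff₀ (by positivity)]; nlinarith
    · rw [div_lt_iff₀ (by positivity)]; nlinarith⟩
  left_inv t := by
    have h1 : (d - t : ℝ) ≠ 0 := (sub_pos.2 t.2.2).ne'
    have h2 : (d - a : ℝ) ≠ 0 := (sub_pos.2 had).ne'
    apply Subtype.ext
    simp only []
    have h3 : (1 + (t - a) / (d - t) : ℝ) = (d - a) / (d - t) := by field_simp; ring
    rw [h3, div_eq_iff (div_ne_zero h2 h1)]
    field_simp
    ring
  right_inv u := by
    have : 0 ≤ (u : ℝ) := u.2
    have h1 : (1 + u : ℝ) ≠ 0 := by positivity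
    have h2 : (d - a : ℝ) ≠ 0 := (sub_pos.2 had).ne'
    apply Subtype.ext
    simp only []
    have h3 : (d - (a + u * d) / (1 + u) : ℝ) = (d - a) / (1 + u) := by field_simp; ring
    rw [h3, div_eq_iff (div_ne_zero h2 h1)]
    field_simp
    ring
  continuous_toFun := by
    refine Continuous.subtype_mk ?_ _
    exact Continuous.div (by fun_prop) (by fun_prop) (fun t => (sub_pos.2 t.2.2).ne')
  continuous_invFun := by
    refine Continuous.subtype_mk ?_ _
    exact Continuous.div (by fun_prop) (by fun_prop) (fun u => by have : 0 ≤ (u : ℝ) := u.2; positivity)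

lemma sum_union {Y : Type*} [TopologicalSpace Y] {P Q U W : Set Y} (hU : IsOpen U) (hW : IsOpen W)
    (hPU : P ⊆ U) (hQU : Disjoint Q U) (hQW : Q ⊆ W) (hPW : Disjoint P W) :
    Nonempty (↥P ⊕ ↥Q ≃ₜ ↥(P ∪ Q)) := by
  have hP : IsOpenEmbedding (inclusion (subset_union_left : P ⊆ P ∪ Q)) := by
    refine ⟨IsEmbedding.inclusion _, ?_⟩
    have : range (inclusion (subset_union_left : P ⊆ P ∪ Q)) = Subtype.val ⁻¹' U := by
      rw [range_inclusion]
      ext ⟨x, hx⟩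
      exact ⟨fun h => hPU h, fun h => hx.resolve_right (fun h' => hQU.notMem_of_mem_left h' h)⟩
    rw [this]; exact hU.preimage continuous_subtype_val
  have hQ : IsOpenEmbedding (inclusion (subset_union_right : Q ⊆ P ∪ Q)) := by
    refine ⟨IsEmbedding.inclusion _, ?_⟩
    have : range (inclusion (subset_union_right : Q ⊆ P ∪ Q)) = Subtype.val ⁻¹' W := by
      rw [range_inclusion]
      ext ⟨x, hx⟩
      exact ⟨fun h => hQW h, fun h => hx.resolve_left (fun h' => hPW.notMem_of_mem_left h' h)⟩
    rw [this]; exact hW.preimage continuous_subtype_val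
  let F : ↥P ⊕ ↥Q → ↥(P ∪ Q) := Sum.elim (inclusion subset_union_left) (inclusion subset_union_right)
  have hb : Function.Bijective F := by
    constructor
    · rintro (x | x) (y | y) h
      · exact congrArg _ (hP.injective h)
      · have : (x : Y) = y := congrArg Subtype.val h
        exact absurd (hPU x.2) (fun h' => hQU.notMem_of_mem_left y.2 (this ▸ h'))
      · have : (x : Y) = y := congrArg Subtype.val h
        exact absurd (hPU y.2) (fun h' => hQU.notMem_of_mem_left x.2 (this.symm ▸ h'))
      · exact congrArg _ (hQ.injective h)
    · rintro ⟨x, hx | hx⟩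
      · exact ⟨Sum.inl ⟨x, hx⟩, rfl⟩
      · exact ⟨Sum.inr ⟨x, hx⟩, rfl⟩
  exact ⟨(Equiv.ofBijective F hb).toHomeomorphOfContinuousOpen
    (hP.continuous.sumElim hQ.continuous) (hP.isOpenMap.sumElim hQ.isOpenMap)⟩

lemma spine_thm {n : ℕ} {Y : Type*} [TopologicalSpace Y] [T2Space Y] {c : EN n → Y}
    (hc : IsOpenEmbedding c) (g1 g2 : Y ≃ₜ Y) (hp1 : g1 (c 0) = c 0) (hp2 : g2 (c 0) = c 0)
    {a d b : ℝ} (ha : 0 < a) (had : a < d) (hdb : d ≤ b)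
    (hg1 : ∀ x ∈ cB c b, g1 x ∈ cO c b) (hg2 : ∀ x ∈ cB c d, g2.symm x ∈ cO c d)
    (hRA : ∀ x, (∃ j : ℕ, (g2 ^ j).symm x ∈ cB c d) → ∀ j : ℕ, (g1 ^ j).symm x ∈ cB c b)
    {K : Set Y} (hK : ∀ x, x ∈ K ↔ (∀ j : ℕ, (g1 ^ j).symm x ∈ cB c b) ∧
      ¬ ∃ j : ℕ, (g2 ^ j).symm x ∈ cB c d) :
    ∃ C : Set Y, IsCompact C ∧
      Nonempty (↥C ≃ₜ ↥(Metric.sphere (0 : EN n) 1) × ↥(Set.Icc (0 : ℝ) 1)) ∧ IsSpine n C K := by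
  set A : Set Y := {x | ∀ j : ℕ, (g1 ^ j).symm x ∈ cB c b} with hA
  set R : Set Y := {x | ∃ j : ℕ, (g2 ^ j).symm x ∈ cB c d} with hR
  have hb : 0 < b := by linarith
  have hab : a < b := by linarith
  have hAc : IsClosed A := by
    rw [hA, ofPred_forall]
    exact isClosed_iInter fun j => (cB_compact hc b).isClosed.preimage (g1 ^ j).symm.continuous
  have hRo : IsOpen R := by
    have : R = ⋃ j : ℕ, (g2 ^ j).symm ⁻¹' cO c d := by
      ext x
      simp only [hR, mem_ofPred_eq, mem_iUnion, mem_preimage]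
      constructor
      · rintro ⟨j, hj⟩
        exact ⟨j+1, by rw [pow_symm_succ]; exact hg2 _ hj⟩
      · rintro ⟨j, hj⟩
        exact ⟨j, cO_sub_cB c d hj⟩
    rw [this]
    exact isOpen_iUnion fun j => (cO_open hc d).preimage (g2 ^ j).symm.continuous
  have hCB : c '' annu n a b = cB c b \ cO c a := by
    rw [cB, cO, ← image_sdiff hc.injective]
    congr 1
    ext x
    simp [annu, and_comm]
  have hcompact : IsCompact (c '' annu n a b) := by
    rw [hCB]; exact (cB_compact hc b).diff (cO_open hc a)
  have hBaR : cB c d ⊆ R := fun x hx => ⟨0, hx⟩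
  have hRA' : R ⊆ A := fun x hx => hRA x hx
  have hAB : A ⊆ cB c b := fun x hx => hx 0
  have hAO : A ⊆ cO c b := by
    intro x hx
    have := hg1 _ (hx 1)
    simpa using this
  have hOaR : cB c a ⊆ R := (cB_mono c had.le).trans hBaR
  have hsplit : c '' annu n a b \ K = (cB c b \ A) ∪ (R \ cO c a) := by
    rw [hCB]
    ext x
    constructor
    · rintro ⟨⟨h1, h2⟩, h3⟩
      by_cases hx : x ∈ A
      · right
        refine ⟨?_, h2⟩
        by_contra h4
        exact h3 ((hK x).2 ⟨hx, h4⟩)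
      · exact Or.inl ⟨h1, hx⟩
    · rintro (⟨h1, h2⟩ | ⟨h1, h2⟩)
      · refine ⟨⟨h1, fun h => h2 (hRA' (hOaR (cO_sub_cB c a h)))⟩, fun h => h2 ((hK x).1 h).1⟩
      · exact ⟨⟨hAB (hRA' h1), h2⟩, fun h => ((hK x).1 h).2 h1⟩
  obtain ⟨e1⟩ := lemA hc g1 hp1 hb hg1
  obtain ⟨e2⟩ := lemR hc g2 hp2 ha had hg2
  obtain ⟨e3⟩ := sum_union (P := cB c b \ A) (Q := R \ cO c a) (U := Aᶜ) (W := R)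
    hAc.isOpen_compl hRo (fun x hx => hx.2)
    (disjoint_left.2 fun x hx hx' => hx' (hRA' hx.1)) (fun x hx => hx.1)
    (disjoint_left.2 fun x hx hx' => hx.2 (hRA' hx'))
  have hs1 : Metric.closedBall (0 : EN n) b \ {0} = shell n (Ioc 0 b) := by
    ext x; simp [shell, and_comm]
  have hs2 : Metric.ball (0 : EN n) d \ Metric.ball 0 a = shell n (Ico a d) := by
    ext x; simp [shell, and_comm]
  have f1 : ↥(cB c b \ A) ≃ₜ ↥(Metric.sphere (0 : EN n) b) × ↥(Ici (0:ℝ)) :=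
    (e1.trans (Homeomorph.setCongr hs1)).trans
      ((shellHomeo n (fun t ht => ht.1) hb).trans ((Homeomorph.refl _).prodCongr (iocHomeo hb)))
  have f2 : ↥(R \ cO c a) ≃ₜ ↥(Metric.sphere (0 : EN n) a) × ↥(Ici (0:ℝ)) :=
    (e2.trans (Homeomorph.setCongr hs2)).trans
      ((shellHomeo n (fun t ht => ha.trans_le ht.1) ha).trans ((Homeomorph.refl _).prodCongr (icoHomeo had)))
  have hbd : subsetBoundary n (c '' annu n a b) = c '' (Metric.sphere 0 b ∪ Metric.sphere 0 a) := by
    let e : ↥(annu n a b) ≃ₜ ↥(c '' annu n a b) := hc.isEmbedding.homeomorphImage _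
    have he : ∀ z, ((e z : ↥(c '' annu n a b)) : Y) = c z := fun z => rfl
    ext y
    constructor
    · rintro ⟨z, hz, rfl⟩
      obtain ⟨w, rfl⟩ := e.surjective z
      rw [← spaceBoundary_homeo n e, annu_bdry ha hab] at hz
      rw [he]
      refine ⟨w, ?_, rfl⟩
      rcases hz with h | h
      · right; simpa using h
      · left; simpa using h
    · rintro ⟨w, hw, rfl⟩
      have hw' : ‖w‖ = a ∨ ‖w‖ = b := by
        rcases hw with h | h
        · right; simpa using h
        · left; simpa using h
      have hwA : w ∈ annu n a b := by
        rcases hw' with h | h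
        · change ‖w‖ ∈ Icc a b; rw [h]; exact ⟨le_rfl, hab.le⟩
        · change ‖w‖ ∈ Icc a b; rw [h]; exact ⟨hab.le, le_rfl⟩
      refine ⟨e ⟨w, hwA⟩, ?_, rfl⟩
      rw [← spaceBoundary_homeo n e, annu_bdry ha hab]
      exact hw'
  obtain ⟨f3⟩ := sum_union (P := Metric.sphere (0 : EN n) b) (Q := Metric.sphere (0 : EN n) a)
    (U := {x | a < ‖x‖}) (W := {x | ‖x‖ < b}) (isOpen_lt continuous_const continuous_norm)
    (isOpen_lt continuous_norm continuous_const)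
    (fun x hx => by have : ‖x‖ = b := by simpa using hx
                    change a < ‖x‖; linarith)
    (disjoint_left.2 fun x hx hx' => by
      have : ‖x‖ = a := by simpa using hx
      change a < ‖x‖ at hx'; linarith)
    (fun x hx => by have : ‖x‖ = a := by simpa using hx
                    change ‖x‖ < b; linarith)
    (disjoint_left.2 fun x hx hx' => by
      have : ‖x‖ = b := by simpa using hx
      change ‖x‖ < b at hx'; linarith)
  refine ⟨c '' annu n a b, hcompact, ⟨?_⟩, ?_, ⟨?_⟩⟩
  · exact ((hc.isEmbedding.homeomorphImage _).symm.trans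
      (shellHomeo n (fun t ht => ha.trans_le ht.1) one_pos : ↥(shell n (Icc a b)) ≃ₜ _)).trans
      ((Homeomorph.refl _).prodCongr (iccHomeoI a b hab))
  · have h1 : K ⊆ cO c b \ cB c a := fun x hx =>
      ⟨hAO ((hK x).1 hx).1, fun h => ((hK x).1 hx).2 (hOaR h)⟩
    refine h1.trans (interior_maximal ?_ ((cO_open hc b).sdiff (cB_compact hc a).isClosed))
    rw [hCB]
    exact sdiff_subset_sdiff (cO_sub_cB c b) (cO_sub_cB c a)
  · refine (Homeomorph.setCongr hsplit).trans (e3.symm.trans ((f1.sumCongr f2).trans ?_))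
    refine Homeomorph.sumProdDistrib.symm.trans (Homeomorph.prodCongr ?_ (Homeomorph.refl _))
    exact f3.trans ((hc.isEmbedding.homeomorphImage _).trans (Homeomorph.setCongr hbd.symm))


/-! ### Dynamics -/

lemma pow_coe {Y : Type*} [TopologicalSpace Y] (g : Y ≃ₜ Y) (k : ℕ) (x : Y) : (⇑g)^[k] x = (g ^ k) x := by
  induction k generalizing x with
  | zero => rfl
  | succ k ih => rw [Function.iterate_succ_apply, ih, pow_succ_app]

lemma pow_symm_coe {Y : Type*} [TopologicalSpace Y] (g : Y ≃ₜ Y) (k : ℕ) (x : Y) :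
    (⇑g.symm)^[k] x = (g ^ k).symm x := by
  induction k generalizing x with
  | zero => rfl
  | succ k ih => rw [Function.iterate_succ_apply', ih, pow_symm_succ]

lemma exists_chart {n : ℕ} {Y : Type*} [TopologicalSpace Y] (hY : LocallyEuclidean n Y) (p : Y)
    {U : Set Y} (hU : U ∈ 𝓝 p) : ∃ c : EN n → Y, IsOpenEmbedding c ∧ c 0 = p ∧ range c ⊆ U := by
  obtain ⟨V, hV, hpV, W, hW, ⟨h⟩⟩ := hY p
  let ψ : W → Y := fun w => (h.symm w : Y)
  have hψ : IsOpenEmbedding ψ := hV.isOpenEmbedding_subtypeVal.comp h.symm.isOpenEmbedding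
  let q : W := h ⟨p, hpV⟩
  have hq : ψ q = p := by simp [ψ, q]
  have h1 : ψ ⁻¹' U ∈ 𝓝 q := hψ.continuous.continuousAt.preimage_mem_nhds (by rw [hq]; exact hU)
  have h2 : Subtype.val '' (ψ ⁻¹' U) ∈ 𝓝 (q : EN n) := hW.isOpenMap_subtype_val.image_mem_nhds h1
  obtain ⟨r, hr, hball⟩ := Metric.mem_nhds_iff.1 h2
  let e := OpenPartialHomeomorph.univBall (q : EN n) r
  have he : IsOpenEmbedding e := e.isOpenEmbedding (OpenPartialHomeomorph.univBall_source _ _)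
  have het : ∀ x, e x ∈ Metric.ball (q : EN n) r := by
    intro x
    rw [← OpenPartialHomeomorph.univBall_target (q : EN n) hr]
    exact e.map_source (by rw [OpenPartialHomeomorph.univBall_source]; trivial)
  have heW : ∀ x, e x ∈ W := by
    intro x
    obtain ⟨w, _, hw⟩ := hball (het x)
    rw [← hw]; exact w.2
  let k : EN n → W := fun x => ⟨e x, heW x⟩
  have hk : IsOpenEmbedding k := by
    apply IsOpenEmbedding.of_comp k hW.isOpenEmbedding_subtypeVal
    exact he
  refine ⟨ψ ∘ k, hψ.comp hk, ?_, ?_⟩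
  · rw [← hq]
    simp only [Function.comp]
    congr 1
    exact Subtype.ext (OpenPartialHomeomorph.univBall_apply_zero _ _)
  · rintro _ ⟨x, rfl⟩
    obtain ⟨w, hw, hwe⟩ := hball (het x)
    have : k x = w := Subtype.ext hwe.symm
    simp only [Function.comp, this]
    exact hw

lemma omega_mono {Y : Type*} [TopologicalSpace Y] (f : Y → Y) {S T : Set Y} (h : S ⊆ T) :
    omegaSet f S ⊆ omegaSet f T :=
  iInter_mono fun _ => iInter_mono fun _ => closure_mono (iUnion_mono fun _ => iUnion_mono fun _ =>
    image_mono h)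

lemma attr_point {n : ℕ} {Y : Type*} [TopologicalSpace Y] [T2Space Y] {c : EN n → Y}
    (hc : IsOpenEmbedding c) (f : Y ≃ₜ Y) (hA : IsAttractor f {c 0}) :
    f (c 0) = c 0 ∧ ∃ U ∈ 𝓝 (c 0), ∀ W ∈ 𝓝 (c 0), ∃ k0 : ℕ, ∀ k, k0 ≤ k → ∀ x ∈ U, (f ^ k) x ∈ W := by
  obtain ⟨_, U0, hU0, hω⟩ := hA
  rw [nhdsSet_singleton] at hU0
  have hp : f (c 0) = c 0 := by
    have h1 : c 0 ∈ omegaSet f U0 := by rw [← hω]; rfl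
    have h2 : f (c 0) ∈ omegaSet f U0 := by
      simp only [omegaSet, mem_iInter] at h1 ⊢
      intro k hk
      have := image_closure_subset_closure_image f.continuous ⟨_, h1 k hk, rfl⟩
      refine closure_mono ?_ this
      rintro _ ⟨x, hx, rfl⟩
      simp only [mem_iUnion] at hx ⊢
      obtain ⟨j, hj, y, hy, rfl⟩ := hx
      exact ⟨j + 1, by omega, y, hy, Function.iterate_succ_apply' _ _ _⟩
    rw [← hω] at h2
    exact h2
  refine ⟨hp, ?_⟩
  obtain ⟨ε, hε, _, hεU⟩ := cB_small hc isOpen_interior (mem_interior_iff_mem_nhds.2 hU0) one_pos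
  have hconn : IsPreconnected (cO c ε) :=
    (convex_ball (0 : EN n) ε).isPreconnected.image _ hc.continuous.continuousOn
  have hsub : cO c ε ⊆ U0 := (cO_sub_cB c ε).trans (hεU.trans interior_subset)
  have hω' : omegaSet f (cO c ε) ⊆ {c 0} := by rw [hω]; exact omega_mono f hsub
  refine ⟨cO c ε, (cO_open hc ε).mem_nhds (cO_zero c hε), fun W hW => ?_⟩
  obtain ⟨δ, hδ, _, hδW⟩ := cB_small hc isOpen_interior (mem_interior_iff_mem_nhds.2 hW) one_pos
  let S : Set Y := cB c δ \ cO c δ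
  have hS : IsCompact S := (cB_compact hc δ).diff (cO_open hc δ)
  let T : ℕ → Set Y := fun k => closure (⋃ (j : ℕ) (_ : k ≤ j), (⇑f)^[j] '' cO c ε)
  have hTanti : Antitone T := by
    intro i j hij
    apply closure_mono
    refine iUnion_mono fun l => ?_
    exact iUnion_mono' fun h => ⟨hij.trans h, le_rfl⟩
  have hTω : ⋂ k, T k ⊆ omegaSet f (cO c ε) := by
    intro x hx
    simp only [omegaSet, mem_iInter]
    intro k _
    exact mem_iInter.1 hx k
  obtain ⟨k0, hk0⟩ : ∃ k, S ∩ T k = ∅ := by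
    apply hS.elim_directed_family_closed T (fun _ => isClosed_closure) _ (directed_of_isDirected_le hTanti)
    apply eq_empty_of_forall_notMem
    rintro x ⟨hx, hxT⟩
    have : x = c 0 := hω' (hTω hxT)
    rw [this] at hx
    exact hx.2 (cO_zero c hδ)
  refine ⟨k0, fun k hk x hx => ?_⟩
  apply interior_subset
  apply hδW
  apply cO_sub_cB
  by_contra hnot
  have hconn' : IsPreconnected ((f ^ k) '' cO c ε) := hconn.image _ (f ^ k).continuous.continuousOn
  have hnS : ∀ z ∈ cO c ε, (f ^ k) z ∉ S := by
    intro z hz hyS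
    have : (f ^ k) z ∈ S ∩ T k0 := by
      refine ⟨hyS, subset_closure ?_⟩
      simp only [mem_iUnion]
      exact ⟨k, hk, z, hz, pow_coe f k z⟩
    rw [hk0] at this
    exact this
  have hcov : ∀ z ∈ cO c ε, (f ^ k) z ∈ cO c δ ∨ (f ^ k) z ∈ (cB c δ)ᶜ := by
    intro z hz
    by_contra! h
    exact hnS z hz ⟨not_not.1 h.2, h.1⟩
  obtain ⟨y, _, hy1, hy2⟩ := hconn' (cO c δ) (cB c δ)ᶜ (cO_open hc δ)
    (cB_compact hc δ).isClosed.isOpen_compl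
    (by rintro _ ⟨z, hz, rfl⟩; exact hcov z hz)
    ⟨c 0, ⟨c 0, cO_zero c hε, pow_fix f hp k⟩, cO_zero c hδ⟩
    ⟨_, ⟨x, hx, rfl⟩, (hcov x hx).resolve_left hnot⟩
  exact hy2 (cO_sub_cB c δ hy1)

/-- decreasing compacta eventually enter a neighbourhood of the intersection -/
lemma compact_enter {Y : Type*} [TopologicalSpace Y] [T2Space Y] {S : ℕ → Set Y} (hS : ∀ k, IsCompact (S k))
    (hanti : Antitone S) {W : Set Y} (hW : IsOpen W) (h : ⋂ k, S k ⊆ W) : ∃ k, S k ⊆ W := by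
  obtain ⟨k, hk⟩ : ∃ k, (S 0 \ W) ∩ S k = ∅ := by
    apply ((hS 0).diff hW).elim_directed_family_closed S (fun k => (hS k).isClosed) _
      (directed_of_isDirected_le hanti)
    apply eq_empty_of_forall_notMem
    rintro x ⟨hx, hxT⟩
    exact hx.2 (h hxT)
  refine ⟨k, fun x hx => ?_⟩
  by_contra hn
  have : x ∈ (S 0 \ W) ∩ S k := ⟨⟨hanti (Nat.zero_le k) hx, hn⟩, hx⟩
  rw [hk] at this
  exact this

lemma pow_add_app {Y : Type*} [TopologicalSpace Y] (g : Y ≃ₜ Y) (j k : ℕ) (x : Y) :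
    (g ^ (j + k)) x = (g ^ j) ((g ^ k) x) := by rw [pow_add]; rfl

lemma attr_of_trap {Y : Type*} [TopologicalSpace Y] [T2Space Y] [RegularSpace Y] (F : Y ≃ₜ Y) {m : ℕ}
    {U K : Set Y} (hU : IsCompact U) (hm : 1 ≤ m) (hUU : ∀ x ∈ U, (F ^ m) x ∈ interior U)
    (hK : ∀ x, x ∈ K ↔ ∀ i : ℕ, ((F ^ m) ^ i).symm x ∈ U) (hF : ∀ x, F x ∈ K ↔ x ∈ K) :
    IsCompact K ∧ IsAttractor F K := by
  set G := F ^ m with hG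
  have hFk : ∀ k : ℕ, ∀ x, (F ^ k) x ∈ K ↔ x ∈ K := by
    intro k
    induction k with
    | zero => intro x; rfl
    | succ k ih => intro x; rw [pow_succ_app, ih, hF]
  have hKc : IsCompact K := by
    have : K = ⋂ i : ℕ, (G ^ i).symm ⁻¹' U := by
      ext x; rw [hK]; simp
    apply hU.of_isClosed_subset
    · rw [this]
      exact isClosed_iInter fun i => hU.isClosed.preimage (G ^ i).symm.continuous
    · intro x hx
      exact (hK x).1 hx 0
  have hconv : ∀ W : Set Y, IsOpen W → K ⊆ W → ∃ k0 : ℕ, ∀ k, k0 ≤ k → ∀ x ∈ U, (F ^ k) x ∈ W := by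
    intro W hW hKW
    let W' : Set Y := ⋂ r : Fin m, (F ^ (r : ℕ)) ⁻¹' W
    have hW' : IsOpen W' := isOpen_iInter_of_finite fun r => hW.preimage (F ^ (r : ℕ)).continuous
    have hKW' : K ⊆ W' := by
      intro x hx
      exact mem_iInter.2 fun r => hKW ((hFk _ x).2 hx)
    have hGU : ∀ x ∈ U, G x ∈ U := fun x hx => interior_subset (hUU x hx)
    obtain ⟨q, hq⟩ := compact_enter (S := fun i => (G ^ i) '' U) (fun i => hU.image (G ^ i).continuous)
      (by
        apply antitone_nat_of_succ_le
        rintro i _ ⟨x, hx, rfl⟩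
        exact ⟨G x, hGU x hx, (pow_succ_app G i x).symm⟩) hW' (by
        intro x hx
        apply hKW'
        rw [hK]
        intro i
        obtain ⟨y, hy, hyx⟩ := mem_iInter.1 hx i
        rw [← hyx, Homeomorph.symm_apply_apply]; exact hy)
    refine ⟨m * q, fun k hk x hx => ?_⟩
    obtain ⟨s, rfl⟩ := Nat.exists_eq_add_of_le hk
    have h1 : m * q + s = s % m + (m * q + m * (s / m)) := by
      have := Nat.mod_add_div s m
      omega
    rw [h1, pow_add_app, ← mul_add, pow_mul, ← hG, pow_add_app]
    have h2 : (G ^ q) ((G ^ (s / m)) x) ∈ W' := hq ⟨_, pow_maps G hGU _ x hx, rfl⟩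
    exact mem_iInter.1 h2 ⟨s % m, Nat.mod_lt _ hm⟩
  refine ⟨hKc, hKc, U, ?_, ?_⟩
  · rw [mem_nhdsSet_iff_forall]
    intro x hx
    rw [← mem_interior_iff_mem_nhds]
    have := hUU _ ((hK x).1 hx 1)
    simpa using this
  · apply Subset.antisymm
    · intro x hx
      simp only [omegaSet, mem_iInter]
      intro k _
      apply subset_closure
      simp only [mem_iUnion]
      refine ⟨k, le_rfl, (F ^ k).symm x, ?_, by rw [pow_coe, Homeomorph.apply_symm_apply]⟩
      have : (F ^ k).symm x ∈ K := by rw [← hFk k, Homeomorph.apply_symm_apply]; exact hx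
      exact (hK _).1 this 0
    · intro x hx
      by_contra hxK
      obtain ⟨O1, O2, h1, h2, hx1, hK2, hd⟩ := SeparatedNhds.of_isCompact_isClosed
        (isCompact_singleton (x := x)) hKc.isClosed (disjoint_singleton_left.2 hxK)
      obtain ⟨k0, hk0⟩ := hconv O2 h2 hK2
      simp only [omegaSet, mem_iInter] at hx
      have h3 := hx (k0 + 1) (by omega)
      rw [mem_closure_iff] at h3
      obtain ⟨y, hy1, hy2⟩ := h3 O1 h1 (hx1 rfl)
      simp only [mem_iUnion] at hy2
      obtain ⟨k, hk, z, hz, rfl⟩ := hy2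
      rw [pow_coe] at hy1
      exact disjoint_left.1 hd hy1 (hk0 k (by omega) z hz)

lemma family_tube {M : Type*} [TopologicalSpace M] (f : unitInterval → M ≃ₜ M) (hf : ContinuousFamily f)
    {Q W : Set M} (hQ : IsCompact Q) (hW : IsOpen W) (k : ℕ) (h : ∀ x ∈ Q, (f 0 ^ k) x ∈ W) :
    ∃ ε : ℝ, 0 < ε ∧ ∀ lam : unitInterval, (lam : ℝ) < ε → ∀ x ∈ Q, (f lam ^ k) x ∈ W := by
  have hcont : ∀ k : ℕ, Continuous (fun q : unitInterval × M => (f q.1 ^ k) q.2) := by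
    intro k
    induction k with
    | zero => exact continuous_snd
    | succ k ih =>
      simp only [pow_succ_app]
      exact ih.comp (continuous_fst.prodMk hf.1)
  have hev : ∀ᶠ lam in 𝓝 (0 : unitInterval), ∀ x ∈ Q, (f lam ^ k) x ∈ W := by
    apply hQ.eventually_forall_of_forall_eventually
    intro x hx
    exact (hcont k).continuousAt.preimage_mem_nhds (hW.mem_nhds (h x hx))
  obtain ⟨ε, hε, h'⟩ := Metric.eventually_nhds_iff.1 hev
  refine ⟨ε, hε, fun lam hl => h' ?_⟩
  rw [Subtype.dist_eq, Real.dist_eq]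
  simpa [abs_of_nonneg lam.2.1] using hl


lemma pow_symm_add {Y : Type*} [TopologicalSpace Y] (g : Y ≃ₜ Y) (j k : ℕ) (x : Y) :
    (g ^ (j + k)).symm x = (g ^ k).symm ((g ^ j).symm x) := by
  rw [Homeomorph.symm_apply_eq, pow_add_app, Homeomorph.apply_symm_apply, Homeomorph.apply_symm_apply]

lemma pow_symm_back {Y : Type*} [TopologicalSpace Y] (g : Y ≃ₜ Y) (j k : ℕ) (x : Y) :
    (g ^ k) ((g ^ (j + k)).symm x) = (g ^ j).symm x := by
  rw [pow_symm_add, Homeomorph.apply_symm_apply]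

lemma pow_symm_succ_app {Y : Type*} [TopologicalSpace Y] (g : Y ≃ₜ Y) (k : ℕ) (x : Y) :
    (g ^ (k + 1)).symm (g x) = (g ^ k).symm x := by
  rw [Homeomorph.symm_apply_eq, pow_succ_app', Homeomorph.apply_symm_apply]

lemma inv_pow_app {Y : Type*} [TopologicalSpace Y] (g : Y ≃ₜ Y) (k : ℕ) (x : Y) :
    (g.symm ^ k) x = (g ^ k).symm x := by
  rw [← pow_coe, pow_symm_coe]

lemma core {n : ℕ} {M : Type*} [MetricSpace M] (F : M ≃ₜ M) (N : Set M) (h : ↥N ≃ₜ ↥N)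
    (hh : ∀ x : ↥N, (h x : M) = F x) {c : EN n → ↥N} (hc : IsOpenEmbedding c)
    {Q W : Set M} (hQc : IsCompact Q) {m : ℕ} (hm : 1 ≤ m)
    (hQ : ∀ k, m ≤ k → ∀ x ∈ Q, (F ^ k) x ∈ interior Q) (hW : ∀ x ∈ Q, (F ^ m) x ∈ W)
    (hWc : ∀ x : ↥N, (x : M) ∈ W → x ∈ cO c 1) (hBQ : ∀ x ∈ cB c 1, (x : M) ∈ Q)
    (hAN : ∀ x, (∀ k : ℕ, (F ^ k) x ∈ Q ∧ (F ^ k).symm x ∈ Q) → x ∈ N)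
    (hrep : IsRepeller h {c 0}) :
    ∃ K : Set M, (∀ x ∈ K, ∀ k : ℕ, (F ^ k).symm x ∈ Q) ∧ IsCompact K ∧ IsAttractor F K ∧ K ⊆ N ∧
      ∃ C : Set ↥N, IsCompact C ∧
          Nonempty (↥C ≃ₜ
            ↥(Metric.sphere (0 : EuclideanSpace ℝ (Fin n)) 1) × ↥(Set.Icc (0 : ℝ) 1)) ∧
          IsSpine n C (Subtype.val ⁻¹' K) := by
  have hck : ∀ (k : ℕ) (x : ↥N), ((h ^ k) x : M) = (F ^ k) x := by
    intro k
    induction k with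
    | zero => intro x; rfl
    | succ k ih => intro x; rw [pow_succ_app, pow_succ_app, ih, hh]
  have hcs : ∀ (k : ℕ) (x : ↥N), ((h ^ k).symm x : M) = (F ^ k).symm x := by
    intro k x
    rw [Homeomorph.eq_symm_apply, ← hck, Homeomorph.apply_symm_apply]
  set A : Set M := {x | ∀ k : ℕ, (F ^ k).symm x ∈ Q} with hAdef
  have hfreq : ∀ x, (∀ k : ℕ, ∃ j, k ≤ j ∧ (F ^ j).symm x ∈ Q) → x ∈ A := by
    intro x hx k
    obtain ⟨j, hj, hjx⟩ := hx (k + m)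
    obtain ⟨i, rfl⟩ := Nat.exists_eq_add_of_le (show k ≤ j by omega)
    rw [← pow_symm_back F k i]
    exact interior_subset (hQ i (by omega) _ hjx)
  have hAF : ∀ x, F x ∈ A ↔ x ∈ A := by
    intro x
    constructor
    · intro hx
      exact hfreq x fun k => ⟨k, le_rfl, by rw [← pow_symm_succ_app]; exact hx (k+1)⟩
    · intro hx
      exact hfreq _ fun k => ⟨k + 1, by omega, by rw [pow_symm_succ_app]; exact hx k⟩
  have hAFk : ∀ (k : ℕ) x, (F ^ k) x ∈ A ↔ x ∈ A := by
    intro k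
    induction k with
    | zero => intro x; rfl
    | succ k ih => intro x; rw [pow_succ_app, ih, hAF]
  have hAQ : ∀ x ∈ A, x ∈ Q := fun x hx => hx 0
  have hAsub : ∀ x ∈ A, x ∈ N := by
    intro x hx
    exact hAN x fun k => ⟨hAQ _ ((hAFk k x).2 hx), hx k⟩
  have hAW : ∀ x ∈ A, x ∈ W := by
    intro x hx
    have := hW _ (hx m)
    rwa [Homeomorph.apply_symm_apply] at this
  have hAcl : IsClosed A := by
    rw [hAdef, ofPred_forall]
    exact isClosed_iInter fun j => hQc.isClosed.preimage (F ^ j).symm.continuous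
  -- the repelling point
  obtain ⟨hp', U', hU', hconv⟩ := attr_point hc h.symm hrep
  have hp : h (c 0) = c 0 := by
    have := congrArg h hp'
    rw [h.apply_symm_apply] at this
    exact this.symm
  obtain ⟨d', hd'0, hd'1, hd'U⟩ := cB_small hc isOpen_interior (mem_interior_iff_mem_nhds.2 hU') one_pos
  set d := d' with hd
  obtain ⟨k0, hk0⟩ := hconv (cO c d) ((cO_open hc d).mem_nhds (cO_zero c hd'0))
  have hk0' : ∀ k, k0 ≤ k → ∀ x ∈ cB c d, (h ^ k).symm x ∈ cO c d := by
    intro k hk x hx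
    rw [← inv_pow_app]
    exact hk0 k hk x (interior_subset (hd'U hx))
  set m2 := k0 + m with hm2
  set g1 := h ^ m with hg1d
  set g2 := h ^ m2 with hg2d
  set G := F ^ m2 with hGd
  have hg1 : ∀ x ∈ cB c 1, g1 x ∈ cO c 1 := by
    intro x hx
    apply hWc
    rw [hg1d, hck]
    exact hW _ (hBQ x hx)
  have hg2 : ∀ x ∈ cB c d, g2.symm x ∈ cO c d := hk0' m2 (by omega)
  have hA1 : ∀ x : ↥N, (∀ j : ℕ, (g1 ^ j).symm x ∈ cB c 1) ↔ (x : M) ∈ A := by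
    intro x
    constructor
    · intro hx
      apply hfreq
      intro k
      refine ⟨m * k, Nat.le_mul_of_pos_left k hm, ?_⟩
      rw [← hcs, pow_mul]
      exact hBQ _ (hx k)
    · intro hx j
      apply cO_sub_cB
      apply hWc
      rw [hg1d, ← pow_mul, hcs]
      apply hAW
      rw [← hAFk (m * j), Homeomorph.apply_symm_apply]
      exact hx
  set R : Set ↥N := {x | ∃ j : ℕ, (g2 ^ j).symm x ∈ cB c d} with hRdef
  have hRev : ∀ x, x ∈ R ↔ ∃ k1 : ℕ, ∀ k, k1 ≤ k → (h ^ k).symm x ∈ cB c d := by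
    intro x
    constructor
    · rintro ⟨j, hj⟩
      rw [hg2d, ← pow_mul] at hj
      refine ⟨m2 * j + k0, fun k hk => ?_⟩
      obtain ⟨i, rfl⟩ := Nat.exists_eq_add_of_le (show m2 * j ≤ k by omega)
      rw [pow_symm_add]
      exact cO_sub_cB c d (hk0' i (by omega) _ hj)
    · rintro ⟨k1, hk1⟩
      refine ⟨k1, ?_⟩
      rw [hg2d, ← pow_mul]
      exact hk1 _ (Nat.le_mul_of_pos_left k1 (by omega))
  have hRF : ∀ x, h x ∈ R ↔ x ∈ R := by
    intro x
    rw [hRev, hRev]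
    constructor
    · rintro ⟨k1, hk1⟩
      exact ⟨k1, fun k hk => by rw [← pow_symm_succ_app]; exact hk1 _ (by omega)⟩
    · rintro ⟨k1, hk1⟩
      refine ⟨k1 + 1, fun k hk => ?_⟩
      obtain ⟨i, rfl⟩ := Nat.exists_eq_add_of_le (show 1 ≤ k by omega)
      rw [add_comm 1 i, pow_symm_succ_app]
      exact hk1 _ (by omega)
  have hRA : ∀ x : ↥N, x ∈ R → (x : M) ∈ A := by
    intro x hx
    obtain ⟨k1, hk1⟩ := (hRev x).1 hx
    apply hfreq
    intro k
    refine ⟨k + k1, by omega, ?_⟩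
    rw [← hcs]
    exact hBQ _ (cB_mono c hd'1 (hk1 _ (by omega)))
  let K : Set M := {x | x ∈ A ∧ ∀ hx : x ∈ N, (⟨x, hx⟩ : ↥N) ∉ R}
  have hKN : ∀ x : ↥N, (x : M) ∈ K ↔ (x : M) ∈ A ∧ x ∉ R := by
    intro x
    exact ⟨fun hx => ⟨hx.1, hx.2 x.2⟩, fun hx => ⟨hx.1, fun _ => hx.2⟩⟩
  have hKF : ∀ x, F x ∈ K ↔ x ∈ K := by
    intro x
    by_cases hx : x ∈ A
    · have hxN := hAsub x hx
      have h1 := hKN ⟨x, hxN⟩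
      have h2 := hKN (h ⟨x, hxN⟩)
      rw [hRF, hh, hAF] at h2
      exact h2.trans h1.symm
    · exact ⟨fun h' => absurd ((hAF x).1 h'.1) hx, fun h' => absurd h'.1 hx⟩
  have hKFk : ∀ (k : ℕ) x, (F ^ k) x ∈ K ↔ x ∈ K := by
    intro k
    induction k with
    | zero => intro x; rfl
    | succ k ih => intro x; rw [pow_succ_app, ih, hKF]
  -- the trapping region
  have hG2 : ∀ x : ↥N, (g2 x : M) = G x := hck m2
  have hGs : ∀ (j : ℕ) (x : ↥N), ((g2 ^ j).symm x : M) = (G ^ j).symm x := by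
    intro j x
    rw [hg2d, hGd, ← pow_mul, ← pow_mul, hcs]
  obtain ⟨O2, hO2, hO2e⟩ := isOpen_induced_iff.1 (g2.isOpenMap _ (cO_open hc d))
  have hO2' : ∀ x : ↥N, (x : M) ∈ O2 ↔ g2.symm x ∈ cO c d := by
    intro x
    have : x ∈ Subtype.val ⁻¹' O2 ↔ x ∈ g2 '' cO c d := by rw [hO2e]
    rw [← mem_preimage, this, g2.image_eq_preimage_symm]; rfl
  obtain ⟨G', V2, hG'o, hV2o, hG'1, hV22, hdisj⟩ := SeparatedNhds.of_isCompact_isClosed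
    (s := Subtype.val '' cB c d) (t := A \ O2)
    ((cB_compact hc d).image continuous_subtype_val) (hAcl.sdiff hO2) (by
      rw [disjoint_left]
      rintro _ ⟨x, hx, rfl⟩ hx2
      exact hx2.2 ((hO2' x).2 (hg2 x hx)))
  have hclG : ∀ x ∈ A, x ∈ closure G' → x ∈ O2 := by
    intro x hx hxc
    by_contra hn
    have hx2 : x ∈ V2 := hV22 ⟨hx, hn⟩
    exact disjoint_left.1 (hdisj.closure_left hV2o) hxc hx2
  have hAG : ∀ y, (∀ j : ℕ, ∃ i, j ≤ i ∧ (G ^ i).symm y ∈ Q) → y ∈ A := by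
    intro y hy
    apply hfreq
    intro k
    obtain ⟨i, hi, hiy⟩ := hy k
    refine ⟨m2 * i, hi.trans (Nat.le_mul_of_pos_left i (by omega)), ?_⟩
    rw [pow_mul]; exact hiy
  have hGQ : ∀ x ∈ Q, G x ∈ interior Q := hQ m2 (by omega)
  obtain ⟨j, hj⟩ := compact_enter (S := fun j => G '' ((G ^ j) '' Q \ G') ∩ closure G')
    (fun j => (((hQc.image (G ^ j).continuous).diff hG'o).image G.continuous).inter_right isClosed_closure)
    (by
      apply antitone_nat_of_succ_le
      rintro i _ ⟨⟨_, ⟨⟨x, hx, rfl⟩, hxG⟩, rfl⟩, hx2⟩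
      exact ⟨⟨_, ⟨⟨G x, interior_subset (hGQ x hx), (pow_succ_app G i x).symm⟩, hxG⟩, rfl⟩, hx2⟩)
    isOpen_empty (by
      intro x hx
      rw [mem_iInter] at hx
      have hy : G.symm x ∈ A := by
        apply hAG
        intro i
        obtain ⟨⟨y, ⟨⟨z, hz, rfl⟩, _⟩, rfl⟩, _⟩ := hx i
        refine ⟨i, le_rfl, ?_⟩
        rw [G.symm_apply_apply, Homeomorph.symm_apply_apply]
        exact hz
      have hxA : x ∈ A := by
        have := (hAFk m2 _).2 hy
        rwa [← hGd, G.apply_symm_apply] at this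
      have hxO := hclG x hxA (hx 0).2
      have hxo := (hO2' ⟨x, hAsub x hxA⟩).1 hxO
      have h3 : ((g2.symm ⟨x, hAsub x hxA⟩ : ↥N) : M) = G.symm x := hcs m2 _
      have h4 : G.symm x ∈ G' := by
        apply hG'1
        exact ⟨_, cO_sub_cB c d hxo, h3⟩
      obtain ⟨⟨y, ⟨_, hyG⟩, hyx⟩, _⟩ := hx 0
      apply absurd h4
      rw [← hyx, G.symm_apply_apply]
      exact hyG)
  have hatt := attr_of_trap F (m := m2) (U := (G ^ j) '' Q \ G') (K := K)
    ((hQc.image (G ^ j).continuous).diff hG'o) (by omega) (by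
      rintro x ⟨⟨y, hy, rfl⟩, hxG⟩
      rw [← hGd]
      have h1 : (G ^ j) '' interior Q ∩ (closure G')ᶜ ⊆ interior ((G ^ j) '' Q \ G') := by
        apply interior_maximal
        · rintro z ⟨⟨w, hw, rfl⟩, hz⟩
          exact ⟨⟨w, interior_subset hw, rfl⟩, fun hz' => hz (subset_closure hz')⟩
        · exact ((G ^ j).isOpenMap _ isOpen_interior).inter isClosed_closure.isOpen_compl
      apply h1
      refine ⟨⟨G y, hGQ y hy, ?_⟩, fun hn => ?_⟩
      · rw [← pow_succ_app, pow_succ_app']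
      · exact hj ⟨⟨_, ⟨⟨y, hy, rfl⟩, hxG⟩, rfl⟩, hn⟩)
    (by
      rw [← hGd]
      intro x
      have hKU : ∀ y ∈ K, y ∈ (G ^ j) '' Q \ G' := by
        intro y hy
        refine ⟨⟨(G ^ j).symm y, ?_, by simp⟩, fun hyG => ?_⟩
        · rw [hGd, ← pow_mul]; exact hy.1 _
        · have h1 := hclG y hy.1 (subset_closure hyG)
          have hyN := hAsub y hy.1
          have h2 := (hO2' ⟨y, hyN⟩).1 h1
          apply hy.2 hyN
          exact ⟨1, by rw [pow_one]; exact cO_sub_cB c d h2⟩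
      constructor
      · intro hx i
        apply hKU
        rw [hGd, ← pow_mul, ← hKFk (m2 * i), Homeomorph.apply_symm_apply]
        exact hx
      · intro hx
        refine ⟨hAG x fun i => ?_, ?_⟩
        · obtain ⟨z, hz, hzx⟩ := (hx i).1
          refine ⟨i + j, by omega, ?_⟩
          rw [pow_symm_add, ← hzx, Homeomorph.symm_apply_apply]
          exact hz
        · rintro hxN ⟨i, hi⟩
          apply (hx i).2
          apply hG'1
          exact ⟨_, hi, hGs i _⟩)
    hKF
  refine ⟨K, fun x hx => hx.1, hatt.1, hatt.2, fun x hx => hAsub x hx.1, ?_⟩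
  apply spine_thm hc g1 g2 (pow_fix h hp _) (pow_fix h hp _) (half_pos hd'0) (half_lt_self hd'0) hd'1 hg1 hg2
  · intro x hx
    exact (hA1 x).2 (hRA x hx)
  · intro x
    rw [mem_preimage, hKN, hA1]
    rfl

lemma family_tube_fin {M : Type*} [TopologicalSpace M] (f : unitInterval → M ≃ₜ M)
    (hf : ContinuousFamily f) {Q W : Set M} (hQ : IsCompact Q) (hW : IsOpen W) (m : ℕ)
    (h : ∀ k, m ≤ k → ∀ x ∈ Q, (f 0 ^ k) x ∈ W) (l : ℕ) :
    ∃ ε : ℝ, 0 < ε ∧ ∀ lam : unitInterval, (lam : ℝ) < ε →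
      ∀ k, m ≤ k → k < l → ∀ x ∈ Q, (f lam ^ k) x ∈ W := by
  induction l with
  | zero => exact ⟨1, one_pos, fun _ _ k _ hk => absurd hk (Nat.not_lt_zero k)⟩
  | succ l ih =>
    obtain ⟨ε, hε, H⟩ := ih
    by_cases hl : m ≤ l
    · obtain ⟨δ, hδ, H2⟩ := family_tube f hf hQ hW l (h l hl)
      refine ⟨min ε δ, lt_min hε hδ, fun lam hlam k hk hkl => ?_⟩
      rcases Nat.lt_succ_iff_lt_or_eq.1 hkl with h1 | h1
      · exact H lam (hlam.trans_le (min_le_left _ _)) k hk h1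
      · subst h1
        exact H2 lam (hlam.trans_le (min_le_right _ _))
    · exact ⟨ε, hε, fun lam hlam k hk hkl => H lam hlam k hk (by omega)⟩

/-- **Bifurcation inside an invariant submanifold.** Suppose `N ⊆ M` is an invariant
topological `n`-manifold for the family `f_λ`, `{p} ⊆ N` is an attractor of `f₀` on `M`
and a repeller of the restriction `f_λ|_N` for every `λ > 0`, and some neighborhood `V`
of `p` in `M` is such that for every `λ` the maximal invariant set of `f_λ` inside `V`
is contained in `N`. Then for all sufficiently small `λ > 0` there is a compact
attractor `K_λ ⊆ N` of `f_λ` which is a topological spine of a compact subset of `N`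
homeomorphic to `S^{n-1} × [0,1]`, converging to `{p}` upper semicontinuously. -/
theorem hopf_invariant_submanifold
    {d n : ℕ} (hn : 1 ≤ n)
    {M : Type*} [MetricSpace M] [LocallyCompactSpace M]
    (hM : LocallyEuclidean d M)
    (f : unitInterval → M ≃ₜ M) (hf : ContinuousFamily f)
    (N : Set M) (hN : LocallyEuclidean n ↥N)
    (hinv : ∀ lam : unitInterval, f lam '' N = N)
    (p : M) (hp : p ∈ N)
    (hattr : IsAttractor (f 0) {p})
    (hrep : ∀ lam : unitInterval, 0 < (lam : ℝ) →
      ∀ g : ↥N ≃ₜ ↥N, (∀ x : ↥N, (g x : M) = f lam x) →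
        IsRepeller g {(⟨p, hp⟩ : ↥N)})
    (V : Set M) (hV : V ∈ 𝓝 p)
    (hmaxinv : ∀ lam : unitInterval, ∀ x ∈ V,
      (∀ k : ℕ, (⇑(f lam))^[k] x ∈ V ∧ (⇑(f lam).symm)^[k] x ∈ V) → x ∈ N) :
    ∃ lam₀ : ℝ, 0 < lam₀ ∧ ∃ Kfam : unitInterval → Set M,
      (∀ lam : unitInterval, 0 < (lam : ℝ) → (lam : ℝ) < lam₀ →
        IsCompact (Kfam lam) ∧ IsAttractor (f lam) (Kfam lam) ∧ Kfam lam ⊆ N ∧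
        ∃ C : Set ↥N, IsCompact C ∧
          Nonempty (↥C ≃ₜ
            ↥(Metric.sphere (0 : EuclideanSpace ℝ (Fin n)) 1) × ↥(Set.Icc (0 : ℝ) 1)) ∧
          IsSpine n C (Subtype.val ⁻¹' Kfam lam)) ∧
      (∀ W : Set M, W ∈ 𝓝ˢ ({p} : Set M) → ∃ lam₁ : ℝ, 0 < lam₁ ∧
        ∀ lam : unitInterval, 0 < (lam : ℝ) → (lam : ℝ) < lam₁ → Kfam lam ⊆ W) := by
  classical
  obtain ⟨cM, hcM, hcM0, -⟩ := exists_chart hM p (Filter.univ_mem)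
  have hattr2 : IsAttractor (f 0) {cM 0} := by rw [hcM0]; exact hattr
  obtain ⟨-, U, hU, hconv⟩ := attr_point hcM (f 0) hattr2
  rw [hcM0] at hU hconv
  obtain ⟨Q, hQn, hQs, hQc⟩ := local_compact_nhds (Filter.inter_mem hU hV)
  have hpQ : p ∈ interior Q := mem_interior_iff_mem_nhds.2 hQn
  obtain ⟨c, hc, hc0, hcr⟩ := exists_chart hN (⟨p, hp⟩ : ↥N)
    (U := Subtype.val ⁻¹' interior Q)
    ((isOpen_interior.preimage continuous_subtype_val).mem_nhds hpQ)
  obtain ⟨W, hWo, hWe⟩ := isOpen_induced_iff.1 (cO_open hc 1)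
  have hpW : p ∈ W := by
    have h1 : (⟨p, hp⟩ : ↥N) ∈ Subtype.val ⁻¹' W := by
      rw [hWe, ← hc0]; exact cO_zero c one_pos
    exact h1
  have hWQo : IsOpen (W ∩ interior Q) := hWo.inter isOpen_interior
  obtain ⟨k0, hk0⟩ := hconv _ (hWQo.mem_nhds ⟨hpW, hpQ⟩)
  obtain ⟨lam₀, hlam₀, hfin⟩ := family_tube_fin f hf hQc hWQo (k0 + 1)
    (fun k hk x hx => hk0 k (by omega) x (hQs hx).1) (2 * (k0 + 1))
  have hall : ∀ lam : unitInterval, (lam : ℝ) < lam₀ → ∀ k, k0 + 1 ≤ k → ∀ x ∈ Q,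
      (f lam ^ k) x ∈ W ∩ interior Q := by
    intro lam hlam k
    induction k using Nat.strong_induction_on with
    | _ k ih =>
      intro hk x hx
      by_cases hk2 : k < 2 * (k0 + 1)
      · exact hfin lam hlam k hk hk2 x hx
      · have e : k = (k - (k0 + 1)) + (k0 + 1) := by omega
        rw [e, pow_add_app]
        exact ih _ (by omega) (by omega) _
          (interior_subset (hfin lam hlam (k0 + 1) le_rfl (by omega) x hx).2)
  have hcore : ∀ lam : unitInterval, ∃ K : Set M, 0 < (lam : ℝ) → (lam : ℝ) < lam₀ →
      (∀ x ∈ K, ∀ k : ℕ, (f lam ^ k).symm x ∈ Q) ∧ IsCompact K ∧ IsAttractor (f lam) K ∧ K ⊆ N ∧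
      ∃ C : Set ↥N, IsCompact C ∧
          Nonempty (↥C ≃ₜ
            ↥(Metric.sphere (0 : EuclideanSpace ℝ (Fin n)) 1) × ↥(Set.Icc (0 : ℝ) 1)) ∧
          IsSpine n C (Subtype.val ⁻¹' K) := by
    intro lam
    by_cases hl : 0 < (lam : ℝ) ∧ (lam : ℝ) < lam₀
    · let h : ↥N ≃ₜ ↥N := ((f lam).image N).trans (Homeomorph.setCongr (hinv lam))
      have hh : ∀ x : ↥N, (h x : M) = f lam x := fun x => rfl
      have hr : IsRepeller h {c 0} := by
        rw [hc0]; exact hrep lam hl.1 h hh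
      obtain ⟨K, hK⟩ := core (f lam) N h hh hc hQc (m := k0 + 1) (W := W) (by omega)
        (fun k hk x hx => (hall lam hl.2 k hk x hx).2)
        (fun x hx => (hall lam hl.2 _ le_rfl x hx).1)
        (fun x hx => by rw [← hWe]; exact hx)
        (fun x hx => by
          obtain ⟨y, -, rfl⟩ := hx
          exact interior_subset (hcr (mem_range_self y)))
        (fun x hx => hmaxinv lam x (hQs (hx 0).1).2 (fun k => by
          rw [pow_coe, pow_symm_coe]
          exact ⟨(hQs (hx k).1).2, (hQs (hx k).2).2⟩)) hr
      exact ⟨K, fun _ _ => hK⟩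
    · exact ⟨∅, fun h1 h2 => absurd ⟨h1, h2⟩ hl⟩
  choose Kfam hKfam using hcore
  refine ⟨lam₀, hlam₀, Kfam, fun lam h1 h2 => (hKfam lam h1 h2).2, fun W' hW' => ?_⟩
  rw [nhdsSet_singleton] at hW'
  obtain ⟨k, hk⟩ := hconv _ (interior_mem_nhds.2 hW')
  obtain ⟨ε, hε, H⟩ := family_tube f hf hQc isOpen_interior k
    (fun x hx => hk k le_rfl x (hQs hx).1)
  refine ⟨min ε lam₀, lt_min hε hlam₀, fun lam h1 h2 x hx => ?_⟩
  have h3 := H lam (h2.trans_le (min_le_left _ _)) _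
    ((hKfam lam h1 (h2.trans_le (min_le_right _ _))).1 x hx k)
  rw [Homeomorph.apply_symm_apply] at h3
  exact interior_subset h3
end

section
/- Characterization of attractors. Let X be a locally compact metric space and f : X → X a homeomorphism. Let K ⊆ X be a compact invariant set (f(K) = K). Then K is an attractor of f if and only if there exists a neighborhood U of K such that for every x ∈ U \ K there exists an integer n_x > 0 with f^{-n_x}(x) ∉ U. -/
open Set Topology unitInterval

variable {X : Type*} [TopologicalSpace X]

/-- **Characterization of attractors.** A compact invariant set `K` of a homeomorphism
`f` of a locally compact metric space is an attractor iff there is a neighborhood `U`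
of `K` such that every `x ∈ U \ K` satisfies `f^{-n}(x) ∉ U` for some `n > 0`. -/
theorem attractor_characterization
    {X : Type*} [MetricSpace X] [LocallyCompactSpace X]
    (f : X ≃ₜ X) (K : Set X) (hKc : IsCompact K) (hKinv : f '' K = K) :
    IsAttractor f K ↔
      ∃ U : Set X, U ∈ 𝓝ˢ K ∧
        ∀ x ∈ U \ K, ∃ m : ℕ, 0 < m ∧ (⇑f.symm)^[m] x ∉ U := by
  constructor
  · rintro ⟨-, U, hU, hK⟩
    refine ⟨U, hU, ?_⟩
    rintro x ⟨hxU, hxK⟩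
    by_contra! hcon
    apply hxK
    rw [hK]
    simp only [omegaSet, mem_iInter]
    intro n hn
    apply subset_closure
    simp only [mem_iUnion]
    exact ⟨n, le_rfl, f.symm^[n] x, hcon n (by omega),
      (Function.LeftInverse.iterate (g := f) (f := f.symm) f.apply_symm_apply n) x⟩
  · rintro ⟨U, hU, hx⟩
    have hfK : ∀ x ∈ K, f x ∈ K := fun x h => hKinv ▸ mem_image_of_mem f h
    have hgK : ∀ x ∈ K, f.symm x ∈ K := by
      intro x h
      rw [← hKinv] at h
      obtain ⟨y, hy, rfl⟩ := h
      simpa using hy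
    have hgiK : ∀ (i : ℕ), ∀ x ∈ K, f.symm^[i] x ∈ K := by
      intro i
      induction i with
      | zero => intro x h; simpa using h
      | succ i ih => intro x h; rw [Function.iterate_succ_apply]; exact ih _ (hgK x h)
    obtain ⟨O, hO, hKO, hOU⟩ := mem_nhdsSet_iff_exists.1 hU
    obtain ⟨N, hN, hKN, hNO⟩ := exists_compact_between hKc hO hKO
    have hNU : N ⊆ U := hNO.trans hOU
    let A : ℕ → Set X := fun n => {x | ∀ i ≤ n, f.symm^[i] x ∈ N}
    have hAanti : ∀ m n, m ≤ n → A n ⊆ A m := fun m n h x hx i hi => hx i (hi.trans h)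
    have hAcl : ∀ n, IsClosed (A n) := by
      intro n
      have : A n = ⋂ (i : ℕ) (_ : i ≤ n), f.symm^[i] ⁻¹' N := by
        ext x; simp [A]
      rw [this]
      exact isClosed_iInter fun i => isClosed_iInter fun _ =>
        hN.isClosed.preimage (f.symm.continuous.iterate i)
    have hAc : ∀ n, IsCompact (A n) := fun n =>
      hN.of_isClosed_subset (hAcl n) (fun x h => h 0 (Nat.zero_le n))
    have hAK : ∀ x, (∀ n, x ∈ A n) → x ∈ K := by
      intro x h
      by_contra hxK
      obtain ⟨m, -, hm⟩ := hx x ⟨hNU (h 0 0 le_rfl), hxK⟩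
      exact hm (hNU (h m m le_rfl))
    have hKA : ∀ n, K ⊆ A n := fun n x h i _ => interior_subset (hKN (hgiK i x h))
    have hW : IsOpen (f ⁻¹' interior N) := isOpen_interior.preimage f.continuous
    obtain ⟨n, hn⟩ : ∃ n, A n ⊆ f ⁻¹' interior N := by
      refine exists_subset_nhds_of_isCompact' (V := A) ?_ hAc hAcl ?_
      · intro a b
        exact ⟨max a b, hAanti _ _ (le_max_left _ _), hAanti _ _ (le_max_right _ _)⟩
      · intro x h
        exact hW.mem_nhds (hKN (hfK x (hAK x (mem_iInter.1 h))))
    have hstep : ∀ k, ∀ x ∈ A n, f^[k] x ∈ A (n + k) := by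
      intro k
      induction k with
      | zero => intro x h; simpa using h
      | succ k ih =>
        intro x h
        rw [Function.iterate_succ_apply']
        have h1 := ih x h
        intro i hi
        cases i with
        | zero => exact interior_subset (hn (hAanti _ _ (Nat.le_add_right n k) h1))
        | succ j =>
          rw [Function.iterate_succ_apply, f.symm_apply_apply]
          exact h1 j (by omega)
    refine ⟨hKc, A n, ?_, ?_⟩
    · rw [mem_nhdsSet_iff_forall]
      intro x h
      have : ∀ᶠ y in 𝓝 x, ∀ i ∈ Set.Iic n, f.symm^[i] y ∈ N := by
        rw [Filter.eventually_all_finite (Set.finite_Iic n)]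
        intro i _
        exact (f.symm.continuous.iterate i).continuousAt.eventually_mem
          (mem_interior_iff_mem_nhds.1 (hKN (hgiK i x h)))
      exact this
    · apply Subset.antisymm
      · intro x h
        simp only [omegaSet, mem_iInter]
        intro m _
        apply subset_closure
        simp only [mem_iUnion]
        exact ⟨m, le_rfl, f.symm^[m] x, hKA n (hgiK m x h),
          (Function.LeftInverse.iterate (g := f) (f := f.symm) f.apply_symm_apply m) x⟩
      · intro x h
        simp only [omegaSet, mem_iInter] at h
        apply hAK
        intro m
        refine closure_minimal ?_ (hAcl m) (h (m + 1) (by omega))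
        intro y hy
        simp only [mem_iUnion] at hy
        obtain ⟨k, hk, z, hz, rfl⟩ := hy
        exact hAanti _ _ (by omega) (hstep k z hz)
end

section
/- Attractors of restrictions to attractors are attractors. Let X be a locally compact metric space and f : X → X a homeomorphism. Suppose K ⊆ X is an attractor of f (in particular K is compact and invariant, so f restricts to a homeomorphism f|_K : K → K of the compact metric space K) and suppose K₀ ⊆ K is an attractor of f|_K. Then K₀ is an attractor of f. -/
open Set Topology unitInterval

variable {X : Type*} [TopologicalSpace X]

theorem omega_mem_iff {Z : Type*} [TopologicalSpace Z] (f : Z → Z) (Y : Set Z) (y : Z) :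
    y ∈ omegaSet f Y ↔ ∀ n : ℕ, 1 ≤ n → y ∈ closure (⋃ (k : ℕ) (_ : n ≤ k), f^[k] '' Y) := by
  simp only [omegaSet, Set.mem_iInter]

theorem tail_preimage {Z : Type*} [TopologicalSpace Z] (f : Z ≃ₜ Z) (Y : Set Z) (n : ℕ) :
    f ⁻¹' (⋃ (k : ℕ) (_ : n + 1 ≤ k), f^[k] '' Y) = ⋃ (k : ℕ) (_ : n ≤ k), f^[k] '' Y := by
  ext y
  simp only [Set.mem_preimage, Set.mem_iUnion, Set.mem_image, exists_prop]
  constructor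
  · rintro ⟨k, hk, x, hx, h⟩
    obtain ⟨j, rfl⟩ : ∃ j, k = j + 1 := ⟨k - 1, by omega⟩
    rw [Function.iterate_succ_apply'] at h
    exact ⟨j, by omega, x, hx, f.injective h⟩
  · rintro ⟨k, hk, x, hx, rfl⟩
    exact ⟨k + 1, by omega, x, hx, by rw [Function.iterate_succ_apply']⟩

theorem tail_anti {Z : Type*} [TopologicalSpace Z] (f : Z → Z) (Y : Set Z) {m n : ℕ} (h : m ≤ n) :
    closure (⋃ (k : ℕ) (_ : n ≤ k), f^[k] '' Y) ⊆ closure (⋃ (k : ℕ) (_ : m ≤ k), f^[k] '' Y) := by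
  apply closure_mono
  intro y
  simp only [Set.mem_iUnion, exists_prop]
  rintro ⟨k, hk, hy⟩
  exact ⟨k, h.trans hk, hy⟩

theorem omega_inv {Z : Type*} [TopologicalSpace Z] (f : Z ≃ₜ Z) (Y : Set Z) (y : Z) :
    f y ∈ omegaSet f Y ↔ y ∈ omegaSet f Y := by
  have key : ∀ n : ℕ, f y ∈ closure (⋃ (k : ℕ) (_ : n + 1 ≤ k), f^[k] '' Y) ↔
      y ∈ closure (⋃ (k : ℕ) (_ : n ≤ k), f^[k] '' Y) := by
    intro n
    rw [← tail_preimage f Y n, ← f.preimage_closure]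
    rfl
  rw [omega_mem_iff, omega_mem_iff]
  constructor
  · intro h n hn
    exact (key n).1 (h (n + 1) (by omega))
  · intro h n hn
    obtain ⟨m, rfl⟩ : ∃ m, n = m + 1 := ⟨n - 1, by omega⟩
    exact (key m).2 (tail_anti f Y (Nat.le_succ m) (h (m + 1) hn))

theorem symm_iter_mem {Z : Type*} [TopologicalSpace Z] (f : Z ≃ₜ Z) (S : Set Z)
    (hS : ∀ y, f y ∈ S ↔ y ∈ S) (i : ℕ) (y : Z) (hy : y ∈ S) : f.symm^[i] y ∈ S := by
  induction i with
  | zero => exact hy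
  | succ i ih =>
    rw [Function.iterate_succ_apply', ← hS, f.apply_symm_apply]
    exact ih

theorem iter_mem {Z : Type*} [TopologicalSpace Z] (f : Z ≃ₜ Z) (S : Set Z)
    (hS : ∀ y, f y ∈ S ↔ y ∈ S) (i : ℕ) (y : Z) (hy : y ∈ S) : f^[i] y ∈ S := by
  induction i with
  | zero => exact hy
  | succ i ih =>
    rw [Function.iterate_succ_apply', hS]
    exact ih

theorem iter_symm {Z : Type*} [TopologicalSpace Z] (f : Z ≃ₜ Z) (i : ℕ) (y : Z) :
    f^[i] (f.symm^[i] y) = y :=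
  Function.LeftInverse.iterate (f := f.symm) (g := f) f.apply_symm_apply i y

theorem symm_iter {Z : Type*} [TopologicalSpace Z] (f : Z ≃ₜ Z) (i : ℕ) (y : Z) :
    f.symm^[i] (f^[i] y) = y :=
  Function.LeftInverse.iterate (f := f) (g := f.symm) f.symm_apply_apply i y

/-- A point whose whole backward orbit (from time one on) is in `Y` is in the omega-limit set. -/
theorem mem_omega_of_back {Z : Type*} [TopologicalSpace Z] (f : Z ≃ₜ Z) (Y : Set Z) (y : Z)
    (h : ∀ i : ℕ, 1 ≤ i → f.symm^[i] y ∈ Y) : y ∈ omegaSet f Y := by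
  rw [omega_mem_iff]
  intro n hn
  apply subset_closure
  simp only [Set.mem_iUnion, exists_prop]
  exact ⟨n, le_rfl, _, h n hn, iter_symm f n y⟩

/-- **Attractors of restrictions to attractors are attractors.** If `K` is an attractor
of a homeomorphism `f` of a locally compact metric space and `K₀ ⊆ K` is an attractor
of the restriction `f|_K`, then `K₀` is an attractor of `f`. -/
theorem attractor_of_restriction
    {X : Type*} [MetricSpace X] [LocallyCompactSpace X]
    (f : X ≃ₜ X) (K : Set X) (hK : IsAttractor f K)
    (K₀ : Set X) (hK₀ : K₀ ⊆ K)
    (hrestr : ∃ g : ↥K ≃ₜ ↥K, (∀ x : ↥K, (g x : X) = f x) ∧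
      IsAttractor g (Subtype.val ⁻¹' K₀)) :
    IsAttractor f K₀ := by
  obtain ⟨hKc, U, hU, hKU⟩ := hK
  obtain ⟨g, hg, hK0c, W, hW, hKW⟩ := hrestr
  have hKinv : ∀ y, f y ∈ K ↔ y ∈ K := by
    intro y; rw [hKU]; exact omega_inv f U y
  have hginv : ∀ y : K, ((g y : K) : X) ∈ K₀ ↔ (y : X) ∈ K₀ := by
    intro y
    have := omega_inv g W y
    rw [← hKW] at this
    exact this
  have hK0inv : ∀ y, f y ∈ K₀ ↔ y ∈ K₀ := by
    intro y
    constructor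
    · intro h
      have hy : y ∈ K := (hKinv y).1 (hK₀ h)
      have := hginv ⟨y, hy⟩
      rw [hg] at this
      exact this.1 h
    · intro h
      have := hginv ⟨y, hK₀ h⟩
      rw [hg] at this
      exact this.2 h
  have hK0 : IsCompact K₀ := by
    have := hK0c.image continuous_subtype_val
    rwa [Subtype.image_preimage_coe, Set.inter_eq_right.2 hK₀] at this
  have hgs : ∀ (i : ℕ) (y : K), ((g.symm^[i] y : K) : X) = f.symm^[i] (y : X) := by
    intro i y
    induction i with
    | zero => rfl
    | succ i ih =>
      rw [Function.iterate_succ_apply', Function.iterate_succ_apply', ← ih]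
      apply f.injective
      rw [← hg, g.apply_symm_apply, f.apply_symm_apply]
  obtain ⟨O, hO, hKO, hOW⟩ := mem_nhdsSet_iff_exists.1 hW
  obtain ⟨O', hO', rfl⟩ := isOpen_induced_iff.1 hO
  have h1 : K₀ ⊆ O' ∩ interior U := by
    intro x hx
    refine ⟨hKO (show (⟨x, hK₀ hx⟩ : K) ∈ _ from hx), ?_⟩
    exact subset_interior_iff_mem_nhdsSet.2 hU (hK₀ hx)
  obtain ⟨C, hC, hKC, hCO⟩ := exists_compact_between hK0 (hO'.inter isOpen_interior) h1
  have hCU : C ⊆ U := fun x hx => interior_subset (hCO hx).2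
  -- points of K with backward orbit in C are in K₀
  have hback : ∀ y ∈ K, (∀ i : ℕ, 1 ≤ i → f.symm^[i] y ∈ C) → y ∈ K₀ := by
    intro y hy h
    have : (⟨y, hy⟩ : K) ∈ omegaSet g W := by
      apply mem_omega_of_back
      intro i hi
      apply hOW
      show ((g.symm^[i] ⟨y, hy⟩ : K) : X) ∈ O'
      rw [hgs]
      exact (hCO (h i hi)).1
    rw [← hKW] at this
    exact this
  let D : ℕ → Set X := fun n =>
    ((interior C)ᶜ ∩ ⋂ (i : ℕ) (_ : 1 ≤ i ∧ i ≤ n + 1), f.symm^[i] ⁻¹' C) ∩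
      closure (⋃ (k : ℕ) (_ : n + 1 ≤ k), f^[k] '' U)
  have hDcl : ∀ n, IsClosed (D n) := by
    intro n
    refine (isOpen_interior.isClosed_compl.inter ?_).inter isClosed_closure
    refine isClosed_iInter fun i => isClosed_iInter fun _ => ?_
    exact hC.isClosed.preimage (f.symm.continuous.iterate i)
  have hDmem : ∀ n y, y ∈ D n ↔ (y ∉ interior C ∧ ∀ i, 1 ≤ i ∧ i ≤ n + 1 → f.symm^[i] y ∈ C) ∧
      y ∈ closure (⋃ (k : ℕ) (_ : n + 1 ≤ k), f^[k] '' U) := by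
    intro n y
    simp only [D, Set.mem_inter_iff, Set.mem_compl_iff, Set.mem_iInter, Set.mem_preimage]
  have hDn : ∃ n, D n = ∅ := by
    by_contra hcon
    push Not at hcon
    have hcomp : IsCompact (D 0) := by
      refine (hC.image f.continuous).of_isClosed_subset (hDcl 0) ?_
      intro y hy
      exact ⟨f.symm y, ((hDmem 0 y).1 hy).1.2 1 (by omega), f.apply_symm_apply y⟩
    obtain ⟨y, hy⟩ := IsCompact.nonempty_iInter_of_sequence_nonempty_isCompact_isClosed D
      (by
        intro n y hy
        rw [hDmem] at hy ⊢
        exact ⟨⟨hy.1.1, fun i hi => hy.1.2 i (by omega)⟩, tail_anti f U (by omega) hy.2⟩)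
      hcon hcomp hDcl
    have hy' := fun n => (hDmem n y).1 (Set.mem_iInter.1 hy n)
    have hyK : y ∈ K := by
      rw [hKU, omega_mem_iff]
      intro n hn
      exact tail_anti f U (by omega) (hy' n).2
    exact (hy' 0).1.1 (hKC (hback y hyK fun i hi => (hy' i).1.2 i (by omega)))
  obtain ⟨n, hn⟩ := hDn
  let P : Set X := ⋂ i ∈ Set.Iic (n + 1), f^[i] ⁻¹' interior C
  have hPmem : ∀ x, x ∈ P ↔ ∀ i, i ≤ n + 1 → f^[i] x ∈ interior C := by
    intro x
    simp only [P, Set.mem_iInter, Set.mem_preimage, Set.mem_Iic]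
  have hPo : IsOpen P :=
    (Set.finite_Iic (n + 1)).isOpen_biInter fun i _ =>
      isOpen_interior.preimage (f.continuous.iterate i)
  have hKP : K₀ ⊆ P := fun x hx => (hPmem x).2 fun i _ => hKC (iter_mem f K₀ hK0inv i x hx)
  have hPC : ∀ x ∈ P, ∀ k, f^[k] x ∈ interior C := by
    intro x hx k
    induction k using Nat.strong_induction_on with
    | _ k ih =>
      by_cases hk : k ≤ n + 1
      · exact (hPmem x).1 hx k hk
      · by_contra hcon
        have : f^[k] x ∈ D n := by
          rw [hDmem]
          refine ⟨⟨hcon, fun i hi => ?_⟩, ?_⟩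
          · obtain ⟨j, rfl⟩ : ∃ j, k = i + j := ⟨k - i, by omega⟩
            rw [Function.iterate_add_apply, symm_iter]
            exact interior_subset (ih j (by omega))
          · apply subset_closure
            simp only [Set.mem_iUnion, exists_prop]
            exact ⟨k, by omega, x, hCU (interior_subset ((hPmem x).1 hx 0 (by omega))), rfl⟩
        rw [hn] at this
        exact this
  have hPU : P ⊆ U := fun x hx => hCU (interior_subset (hPC x hx 0))
  refine ⟨hK0, P, hPo.mem_nhdsSet.2 hKP, Set.Subset.antisymm ?_ ?_⟩
  · intro y hy
    exact mem_omega_of_back f P y fun i _ => hKP (symm_iter_mem f K₀ hK0inv i y hy)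
  · intro y hy
    have hωC : omegaSet f P ⊆ C := by
      intro z hz
      refine closure_minimal ?_ hC.isClosed ((omega_mem_iff f P z).1 hz 1 le_rfl)
      intro w hw
      simp only [Set.mem_iUnion, exists_prop] at hw
      obtain ⟨k, _, x, hx, rfl⟩ := hw
      exact interior_subset (hPC x hx k)
    have hyK : y ∈ K := by
      rw [hKU, omega_mem_iff]
      intro m hm
      refine closure_mono ?_ ((omega_mem_iff f P y).1 hy m hm)
      exact Set.iUnion₂_mono fun k _ => Set.image_mono hPU
    exact hback y hyK fun i _ => hωC (symm_iter_mem f _ (omega_inv f P) i y hy)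
end
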